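/- There exists a positive constant C depending only on β and the initial data such that for every T > 0: ∫₀¹ (w_x + u − θ)²(x,T) dx + ∫₀ᵀ ∫₀¹ ((w_{xx} + u_x − θ_x)² + θ (w_x + u − θ)²) dx dt ≤ C. -/

import Mathlib

open MeasureTheory Real Set Filter Topology

/-- A classical solution on `[0,1] × [0,∞)` of the rescaled stress-free
one-dimensional compressible Navier–Stokes system
`u_t + u = v_x`, `v_t = ((v_x - θ)/u)_x`,
`θ_t = -θ v_x/u + v_x²/u + (θ^β θ_x/u)_x` (β > 0),
with stress-free, thermally insulated boundary conditions and positive data. -/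
structure NSSol where
  β : ℝ
  hβ : 0 < β
  u : ℝ → ℝ → ℝ
  v : ℝ → ℝ → ℝ
  θ : ℝ → ℝ → ℝ
  ux : ℝ → ℝ → ℝ
  ut : ℝ → ℝ → ℝ
  vx : ℝ → ℝ → ℝ
  vt : ℝ → ℝ → ℝ
  vxx : ℝ → ℝ → ℝ
  θx : ℝ → ℝ → ℝ
  θt : ℝ → ℝ → ℝ
  θxx : ℝ → ℝ → ℝ
  hu_pos : ∀ x ∈ Icc (0:ℝ) 1, ∀ t ∈ Ici (0:ℝ), 0 < u x t
  hθ_pos : ∀ x ∈ Icc (0:ℝ) 1, ∀ t ∈ Ici (0:ℝ), 0 < θ x t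
  hux : ∀ x ∈ Icc (0:ℝ) 1, ∀ t ∈ Ici (0:ℝ),
    HasDerivWithinAt (fun y => u y t) (ux x t) (Icc 0 1) x
  hut : ∀ x ∈ Icc (0:ℝ) 1, ∀ t ∈ Ici (0:ℝ),
    HasDerivWithinAt (fun s => u x s) (ut x t) (Ici 0) t
  hvx : ∀ x ∈ Icc (0:ℝ) 1, ∀ t ∈ Ici (0:ℝ),
    HasDerivWithinAt (fun y => v y t) (vx x t) (Icc 0 1) x
  hvt : ∀ x ∈ Icc (0:ℝ) 1, ∀ t ∈ Ici (0:ℝ),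
    HasDerivWithinAt (fun s => v x s) (vt x t) (Ici 0) t
  hvxx : ∀ x ∈ Icc (0:ℝ) 1, ∀ t ∈ Ici (0:ℝ),
    HasDerivWithinAt (fun y => vx y t) (vxx x t) (Icc 0 1) x
  hθx : ∀ x ∈ Icc (0:ℝ) 1, ∀ t ∈ Ici (0:ℝ),
    HasDerivWithinAt (fun y => θ y t) (θx x t) (Icc 0 1) x
  hθt : ∀ x ∈ Icc (0:ℝ) 1, ∀ t ∈ Ici (0:ℝ),
    HasDerivWithinAt (fun s => θ x s) (θt x t) (Ici 0) t
  hθxx : ∀ x ∈ Icc (0:ℝ) 1, ∀ t ∈ Ici (0:ℝ),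
    HasDerivWithinAt (fun y => θx y t) (θxx x t) (Icc 0 1) x
  hu_cont : ContinuousOn (Function.uncurry u) (Icc 0 1 ×ˢ Ici 0)
  hv_cont : ContinuousOn (Function.uncurry v) (Icc 0 1 ×ˢ Ici 0)
  hθ_cont : ContinuousOn (Function.uncurry θ) (Icc 0 1 ×ˢ Ici 0)
  hux_cont : ContinuousOn (Function.uncurry ux) (Icc 0 1 ×ˢ Ici 0)
  hut_cont : ContinuousOn (Function.uncurry ut) (Icc 0 1 ×ˢ Ici 0)
  hvx_cont : ContinuousOn (Function.uncurry vx) (Icc 0 1 ×ˢ Ici 0)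
  hvt_cont : ContinuousOn (Function.uncurry vt) (Icc 0 1 ×ˢ Ici 0)
  hvxx_cont : ContinuousOn (Function.uncurry vxx) (Icc 0 1 ×ˢ Ici 0)
  hθx_cont : ContinuousOn (Function.uncurry θx) (Icc 0 1 ×ˢ Ici 0)
  hθt_cont : ContinuousOn (Function.uncurry θt) (Icc 0 1 ×ˢ Ici 0)
  hθxx_cont : ContinuousOn (Function.uncurry θxx) (Icc 0 1 ×ˢ Ici 0)
  mass : ∀ x ∈ Icc (0:ℝ) 1, ∀ t ∈ Ici (0:ℝ), ut x t + u x t = vx x t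
  momentum : ∀ x ∈ Icc (0:ℝ) 1, ∀ t ∈ Ici (0:ℝ),
    HasDerivWithinAt (fun y => (vx y t - θ y t) / u y t) (vt x t) (Icc 0 1) x
  energyEq : ∀ x ∈ Icc (0:ℝ) 1, ∀ t ∈ Ici (0:ℝ),
    HasDerivWithinAt (fun y => θ y t ^ β * θx y t / u y t)
      (θt x t + θ x t * vx x t / u x t - (vx x t) ^ 2 / u x t) (Icc 0 1) x
  bc0 : ∀ t ∈ Ici (0:ℝ), (vx 0 t - θ 0 t) / u 0 t = 0
  bc1 : ∀ t ∈ Ici (0:ℝ), (vx 1 t - θ 1 t) / u 1 t = 0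
  bcθ0 : ∀ t ∈ Ici (0:ℝ), θx 0 t = 0
  bcθ1 : ∀ t ∈ Ici (0:ℝ), θx 1 t = 0

namespace NSSol

/-- The initial energy `E₀ = ∫₀¹ (v₀²/2 + θ₀) dx`. -/
noncomputable def E₀ (S : NSSol) : ℝ := ∫ x in (0:ℝ)..1, ((S.v x 0) ^ 2 / 2 + S.θ x 0)

/-- The dissipation functional
`V(t) = ∫₀¹ (θ^β θ_x²/(uθ²) + (v_x − θ)²/(uθ)) dx`. -/
noncomputable def V (S : NSSol) (t : ℝ) : ℝ :=
  ∫ x in (0:ℝ)..1,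
    (S.θ x t ^ S.β * (S.θx x t) ^ 2 / (S.u x t * (S.θ x t) ^ 2)
      + (S.vx x t - S.θ x t) ^ 2 / (S.u x t * S.θ x t))

/-- The auxiliary velocity
`w(x,t) = v(x,t) − ∫₀¹ v₀ dξ − ∫₀ˣ u(ξ,t) dξ + ∫₀¹∫₀^ξ u(η,t) dη dξ`,
which satisfies `w_x = v_x − u` and `∫₀¹ w dx = 0`. -/
noncomputable def w (S : NSSol) (x t : ℝ) : ℝ :=
  S.v x t - (∫ ξ in (0:ℝ)..1, S.v ξ 0) - (∫ ξ in (0:ℝ)..x, S.u ξ t)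
    + ∫ ξ in (0:ℝ)..1, ∫ η in (0:ℝ)..ξ, S.u η t

/-- The asymptotic state `A = 2√(36 + 3(2E₀ − (∫₀¹ v₀ dx)²)) − 12`. -/
noncomputable def A (S : NSSol) : ℝ :=
  2 * Real.sqrt (36 + 3 * (2 * S.E₀ - (∫ x in (0:ℝ)..1, S.v x 0) ^ 2)) - 12

end NSSol

/-! ### Functions jointly continuous on `[0,1] × [0,∞)` -/

/-- Joint continuity on `[0,1] × [0,∞)`. -/
def ContRect (F : ℝ → ℝ → ℝ) : Prop :=
  ContinuousOn (fun p : ℝ × ℝ => F p.1 p.2) (Icc 0 1 ×ˢ Ici 0)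

namespace ContRect

variable {F G : ℝ → ℝ → ℝ}

lemma const (c : ℝ) : ContRect fun _ _ => c := continuousOn_const

lemma fst : ContRect fun x _ => x := continuous_fst.continuousOn

lemma add (hF : ContRect F) (hG : ContRect G) : ContRect fun x t => F x t + G x t :=
  ContinuousOn.add hF hG

lemma sub (hF : ContRect F) (hG : ContRect G) : ContRect fun x t => F x t - G x t :=
  ContinuousOn.sub hF hG

lemma mul (hF : ContRect F) (hG : ContRect G) : ContRect fun x t => F x t * G x t :=
  ContinuousOn.mul hF hG

lemma neg (hF : ContRect F) : ContRect fun x t => - F x t :=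
  ContinuousOn.neg hF

lemma abs (hF : ContRect F) : ContRect fun x t => |F x t| :=
  ContinuousOn.abs hF

lemma exp (hF : ContRect F) : ContRect fun x t => Real.exp (F x t) :=
  ContinuousOn.rexp hF

lemma pow (hF : ContRect F) (n : ℕ) : ContRect fun x t => F x t ^ n :=
  ContinuousOn.pow hF n

lemma div (hF : ContRect F) (hG : ContRect G)
    (h : ∀ x ∈ Icc (0 : ℝ) 1, ∀ t ∈ Ici (0 : ℝ), 0 < G x t) :
    ContRect fun x t => F x t / G x t :=
  ContinuousOn.div hF hG fun p hp => (h p.1 hp.1 p.2 hp.2).ne'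

lemma log (hF : ContRect F) (h : ∀ x ∈ Icc (0 : ℝ) 1, ∀ t ∈ Ici (0 : ℝ), 0 < F x t) :
    ContRect fun x t => Real.log (F x t) :=
  ContinuousOn.log hF fun p hp => (h p.1 hp.1 p.2 hp.2).ne'

lemma rpow (hF : ContRect F) (h : ∀ x ∈ Icc (0 : ℝ) 1, ∀ t ∈ Ici (0 : ℝ), 0 < F x t) (a : ℝ) :
    ContRect fun x t => F x t ^ a :=
  ContinuousOn.rpow_const hF fun p hp => Or.inl (h p.1 hp.1 p.2 hp.2).ne'

lemma slice (hF : ContRect F) {t : ℝ} (ht : 0 ≤ t) :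
    ContinuousOn (fun x => F x t) (Icc 0 1) :=
  ContinuousOn.comp (g := fun p : ℝ × ℝ => F p.1 p.2) hF (f := fun x => (x, t))
    (by fun_prop) fun _ hx => ⟨hx, ht⟩

lemma timeSlice (hF : ContRect F) {x : ℝ} (hx : x ∈ Icc (0 : ℝ) 1) :
    ContinuousOn (fun t => F x t) (Ici 0) :=
  ContinuousOn.comp (g := fun p : ℝ × ℝ => F p.1 p.2) hF (f := fun t => (x, t))
    (by fun_prop) fun _ ht => ⟨hx, ht⟩

/-- A function continuous on `[0,1] × [0,∞)` extends to a continuous function on the plane. -/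
lemma exists_continuous (hF : ContRect F) :
    ∃ G : ℝ → ℝ → ℝ, Continuous (fun p : ℝ × ℝ => G p.1 p.2) ∧
      ∀ x ∈ Icc (0 : ℝ) 1, ∀ t ∈ Ici (0 : ℝ), G x t = F x t := by
  refine ⟨fun x t => F (max 0 (min 1 x)) (max 0 t), ?_, ?_⟩
  · refine ContinuousOn.comp_continuous (g := fun p : ℝ × ℝ => F p.1 p.2) hF
      (f := fun p : ℝ × ℝ => (max 0 (min 1 p.1), max 0 p.2)) (by fun_prop) ?_
    intro p
    exact ⟨⟨le_max_left _ _, max_le zero_le_one (min_le_left _ _)⟩, le_max_left (0 : ℝ) p.2⟩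
  · intro x hx t ht
    simp only [min_eq_right hx.2, max_eq_right hx.1, max_eq_right (show (0 : ℝ) ≤ t from ht)]

/-- The primitive in the space variable is jointly continuous. -/
lemma primitive (hF : ContRect F) : ContRect fun x t => ∫ ξ in (0 : ℝ)..x, F ξ t := by
  obtain ⟨G, hG, hGF⟩ := hF.exists_continuous
  have hc : Continuous (fun p : ℝ × ℝ => ∫ ξ in (0 : ℝ)..p.1, G ξ p.2) :=
    intervalIntegral.continuous_parametric_intervalIntegral_of_continuous
      (f := fun (p : ℝ × ℝ) ξ => G ξ p.2) (s := fun p : ℝ × ℝ => p.1)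
      (hG.comp (g := fun p : ℝ × ℝ => G p.1 p.2)
        (f := fun q : (ℝ × ℝ) × ℝ => (q.2, q.1.2)) (by fun_prop)) continuous_fst
  refine hc.continuousOn.congr fun p hp => ?_
  refine intervalIntegral.integral_congr fun ξ hξ => ?_
  rw [uIcc_of_le hp.1.1] at hξ
  exact (hGF ξ ⟨hξ.1, hξ.2.trans hp.1.2⟩ p.2 hp.2).symm

lemma continuousOn_integral (hF : ContRect F) :
    ContinuousOn (fun t => ∫ x in (0 : ℝ)..1, F x t) (Ici 0) :=
  hF.primitive.timeSlice ⟨zero_le_one, le_rfl⟩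

end ContRect

lemma ContinuousOn.intervalIntegrable_sub {f : ℝ → ℝ} (hf : ContinuousOn f (Icc 0 1))
    {y : ℝ} (hy : y ∈ Icc (0 : ℝ) 1) : IntervalIntegrable f volume 0 y :=
  ContinuousOn.intervalIntegrable
    (by rw [uIcc_of_le hy.1]; exact hf.mono (Icc_subset_Icc_right hy.2))

lemma ContinuousOn.intervalIntegrable_unit {f : ℝ → ℝ} (hf : ContinuousOn f (Icc 0 1)) :
    IntervalIntegrable f volume 0 1 :=
  hf.intervalIntegrable_sub ⟨zero_le_one, le_rfl⟩

/-! ### Integral inequalities on `[0,1]` -/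

lemma integral_unit_mono {f g : ℝ → ℝ} (hf : ContinuousOn f (Icc 0 1))
    (hg : ContinuousOn g (Icc 0 1)) (h : ∀ x ∈ Icc (0 : ℝ) 1, f x ≤ g x) :
    ∫ x in (0 : ℝ)..1, f x ≤ ∫ x in (0 : ℝ)..1, g x :=
  intervalIntegral.integral_mono_on zero_le_one hf.intervalIntegrable_unit
    hg.intervalIntegrable_unit h

lemma integral_unit_nonneg {f : ℝ → ℝ} (h : ∀ x ∈ Icc (0 : ℝ) 1, 0 ≤ f x) :
    0 ≤ ∫ x in (0 : ℝ)..1, f x :=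
  intervalIntegral.integral_nonneg zero_le_one h

lemma integral_unit_le_comb {f f₁ f₂ f₃ : ℝ → ℝ} (c₁ c₂ c₃ : ℝ)
    (hf : ContinuousOn f (Icc 0 1)) (h₁ : ContinuousOn f₁ (Icc 0 1))
    (h₂ : ContinuousOn f₂ (Icc 0 1)) (h₃ : ContinuousOn f₃ (Icc 0 1))
    (h : ∀ x ∈ Icc (0 : ℝ) 1, f x ≤ c₁ * f₁ x + c₂ * f₂ x + c₃ * f₃ x) :
    ∫ x in (0 : ℝ)..1, f x ≤ c₁ * (∫ x in (0 : ℝ)..1, f₁ x) + c₂ * (∫ x in (0 : ℝ)..1, f₂ x)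
      + c₃ * ∫ x in (0 : ℝ)..1, f₃ x := by
  have i₁ := h₁.intervalIntegrable_unit.const_mul c₁
  have i₂ := h₂.intervalIntegrable_unit.const_mul c₂
  have i₃ := h₃.intervalIntegrable_unit.const_mul c₃
  rw [← intervalIntegral.integral_const_mul, ← intervalIntegral.integral_const_mul,
    ← intervalIntegral.integral_const_mul, ← intervalIntegral.integral_add i₁ i₂,
    ← intervalIntegral.integral_add (i₁.add i₂) i₃]
  exact intervalIntegral.integral_mono_on zero_le_one hf.intervalIntegrable_unit
    ((i₁.add i₂).add i₃) h

lemma integral_unit_const (c : ℝ) : ∫ _ in (0 : ℝ)..1, c = c := by simp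

lemma integral_unit_le_of_le {f : ℝ → ℝ} {c : ℝ} (hf : ContinuousOn f (Icc 0 1))
    (h : ∀ x ∈ Icc (0 : ℝ) 1, f x ≤ c) : ∫ x in (0 : ℝ)..1, f x ≤ c := by
  have := integral_unit_mono hf continuousOn_const h
  rwa [integral_unit_const] at this

lemma exists_le_integral_unit {f : ℝ → ℝ} (hf : ContinuousOn f (Icc 0 1)) :
    ∃ x ∈ Icc (0 : ℝ) 1, f x ≤ ∫ y in (0 : ℝ)..1, f y := by
  obtain ⟨x, hx, hm⟩ := isCompact_Icc.exists_isMinOn (nonempty_Icc.2 zero_le_one) hf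
  refine ⟨x, hx, ?_⟩
  have := integral_unit_mono (continuousOn_const (c := f x)) hf fun y hy => hm hy
  rwa [integral_unit_const] at this

lemma exists_integral_unit_le {f : ℝ → ℝ} (hf : ContinuousOn f (Icc 0 1)) :
    ∃ x ∈ Icc (0 : ℝ) 1, ∫ y in (0 : ℝ)..1, f y ≤ f x := by
  obtain ⟨x, hx, hm⟩ := isCompact_Icc.exists_isMaxOn (nonempty_Icc.2 zero_le_one) hf
  exact ⟨x, hx, integral_unit_le_of_le hf fun y hy => hm hy⟩

lemma sq_integral_mul_le {f g : ℝ → ℝ} (hf : ContinuousOn f (Icc 0 1))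
    (hg : ContinuousOn g (Icc 0 1)) :
    (∫ x in (0 : ℝ)..1, f x * g x) ^ 2
      ≤ (∫ x in (0 : ℝ)..1, f x ^ 2) * ∫ x in (0 : ℝ)..1, g x ^ 2 := by
  have key : ∀ l : ℝ, 0 ≤ (∫ x in (0 : ℝ)..1, f x ^ 2) * (l * l)
      + (2 * ∫ x in (0 : ℝ)..1, f x * g x) * l + ∫ x in (0 : ℝ)..1, g x ^ 2 := by
    intro l
    have h := integral_unit_le_comb (f := fun _ => 0) (l * l) (2 * l) 1 continuousOn_const
      (hf.pow 2) (hf.mul hg) (hg.pow 2)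
      (fun x _ => by simp only [Pi.mul_apply, Pi.pow_apply]; nlinarith [sq_nonneg (l * f x + g x)])
    rw [integral_unit_const] at h
    simp only [Pi.mul_apply, Pi.pow_apply] at h
    linarith
  have := discrim_le_zero key
  unfold discrim at this
  linarith

/-! ### Fundamental theorem of calculus -/

lemma integral_eq_sub_of_hasDerivWithinAt_unit {g g' : ℝ → ℝ}
    (hd : ∀ x ∈ Icc (0 : ℝ) 1, HasDerivWithinAt g (g' x) (Icc 0 1) x)
    (hc : ContinuousOn g' (Icc 0 1)) {y : ℝ} (hy : y ∈ Icc (0 : ℝ) 1) :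
    ∫ x in (0 : ℝ)..y, g' x = g y - g 0 := by
  refine intervalIntegral.integral_eq_sub_of_hasDerivAt_of_le hy.1
    (fun x hx => ((hd x ⟨hx.1, hx.2.trans hy.2⟩).continuousWithinAt).mono
      (Icc_subset_Icc_right hy.2))
    (fun x hx => (hd x ⟨hx.1.le, hx.2.le.trans hy.2⟩).hasDerivAt
      (Icc_mem_nhds hx.1 (hx.2.trans_le hy.2)))
    (hc.intervalIntegrable_sub hy)

/-- Two integrals coincide if the integrands differ by the derivative of a function vanishing
at both endpoints. -/
lemma integral_unit_eq_of_deriv {g f₁ f₂ : ℝ → ℝ}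
    (hd : ∀ x ∈ Icc (0 : ℝ) 1, HasDerivWithinAt g (f₁ x - f₂ x) (Icc 0 1) x)
    (h₁ : ContinuousOn f₁ (Icc 0 1)) (h₂ : ContinuousOn f₂ (Icc 0 1))
    (g0 : g 0 = 0) (g1 : g 1 = 0) :
    ∫ x in (0 : ℝ)..1, f₁ x = ∫ x in (0 : ℝ)..1, f₂ x := by
  have h := integral_eq_sub_of_hasDerivWithinAt_unit hd (h₁.sub h₂) ⟨zero_le_one, le_rfl⟩
  rw [intervalIntegral.integral_sub h₁.intervalIntegrable_unit h₂.intervalIntegrable_unit,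
    g0, g1] at h
  linarith

lemma abs_sub_le_integral_abs_deriv {g g' : ℝ → ℝ}
    (hd : ∀ x ∈ Icc (0 : ℝ) 1, HasDerivWithinAt g (g' x) (Icc 0 1) x)
    (hc : ContinuousOn g' (Icc 0 1)) {x y : ℝ} (hx : x ∈ Icc (0 : ℝ) 1)
    (hy : y ∈ Icc (0 : ℝ) 1) :
    |g x - g y| ≤ ∫ z in (0 : ℝ)..1, |g' z| := by
  wlog hxy : y ≤ x generalizing x y
  · rw [abs_sub_comm]; exact this hy hx (le_of_not_ge hxy)
  have h1 := integral_eq_sub_of_hasDerivWithinAt_unit hd hc hx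
  have h2 := integral_eq_sub_of_hasDerivWithinAt_unit hd hc hy
  have h3 := intervalIntegral.integral_interval_sub_left (hc.intervalIntegrable_sub hx)
    (hc.intervalIntegrable_sub hy)
  have h4 : g x - g y = ∫ z in y..x, g' z := by linarith
  rw [h4]
  refine (intervalIntegral.abs_integral_le_integral_abs hxy).trans ?_
  exact intervalIntegral.integral_mono_interval hy.1 hxy hx.2
    (Eventually.of_forall fun z => abs_nonneg _) hc.abs.intervalIntegrable_unit

/-! ### Differentiation of integrals with respect to a parameter -/

/-- If `b` is continuously differentiable in the parameter, then
`s ↦ ∫ a(x,s) (b(x,s) - b(x,t)) dx` has derivative `∫ a(x,t) b_t(x,t) dx` at `s = t`. -/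
lemma hasDerivAt_integral_mul_sub {a b b' : ℝ → ℝ → ℝ} {y t : ℝ} {J : Set ℝ} (hy : 0 ≤ y)
    (hJ : J ∈ 𝓝 t)
    (ha : ContinuousOn (fun p : ℝ × ℝ => a p.1 p.2) (Icc 0 y ×ˢ J))
    (hb : ContinuousOn (fun p : ℝ × ℝ => b p.1 p.2) (Icc 0 y ×ˢ J))
    (hb' : ContinuousOn (fun p : ℝ × ℝ => b' p.1 p.2) (Icc 0 y ×ˢ J))
    (hd : ∀ x ∈ Ioo 0 y, ∀ s ∈ J, HasDerivAt (fun r => b x r) (b' x s) s) :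
    HasDerivAt (fun s => ∫ x in (0 : ℝ)..y, a x s * (b x s - b x t))
      (∫ x in (0 : ℝ)..y, a x t * b' x t) t := by
  obtain ⟨ε, hε, hεJ⟩ := Metric.nhds_basis_closedBall.mem_iff.1 hJ
  have htJ : t ∈ Metric.closedBall t ε := Metric.mem_closedBall_self hε.le
  have hK : IsCompact (Icc 0 y ×ˢ Metric.closedBall t ε) :=
    isCompact_Icc.prod (isCompact_closedBall t ε)
  have hsub : Icc 0 y ×ˢ Metric.closedBall t ε ⊆ Icc 0 y ×ˢ J := prod_mono_right hεJ
  obtain ⟨A, hA⟩ := hK.exists_bound_of_continuousOn (ha.mono hsub)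
  obtain ⟨B, hB⟩ := hK.exists_bound_of_continuousOn (hb'.mono hsub)
  have slice : ∀ {f : ℝ → ℝ → ℝ},
      ContinuousOn (fun p : ℝ × ℝ => f p.1 p.2) (Icc 0 y ×ˢ J) → ∀ s ∈ J,
      ContinuousOn (fun x => f x s) (Icc 0 y) := by
    intro f hf s hs
    exact ContinuousOn.comp (g := fun p : ℝ × ℝ => f p.1 p.2) hf (f := fun x => (x, s))
      (by fun_prop) fun _ hx => ⟨hx, hs⟩
  have tslice : ∀ {f : ℝ → ℝ → ℝ},
      ContinuousOn (fun p : ℝ × ℝ => f p.1 p.2) (Icc 0 y ×ˢ J) → ∀ x ∈ Icc 0 y,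
      ContinuousOn (fun s => f x s) J := by
    intro f hf x hx
    exact ContinuousOn.comp (g := fun p : ℝ × ℝ => f p.1 p.2) hf (f := fun s => (x, s))
      (by fun_prop) fun _ hs => ⟨hx, hs⟩
  rw [hasDerivAt_iff_tendsto_slope]
  have hs_eq : slope (fun s => ∫ x in (0 : ℝ)..y, a x s * (b x s - b x t)) t
      = fun s => ∫ x in (0 : ℝ)..y, a x s * ((s - t)⁻¹ * (b x s - b x t)) := by
    funext s
    simp only [slope_def_module, sub_self, mul_zero, intervalIntegral.integral_zero, sub_zero,
      smul_eq_mul]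
    rw [← intervalIntegral.integral_const_mul]
    congr 1; funext x; ring
  rw [hs_eq]
  have hball : ∀ᶠ s in 𝓝[≠] t, s ∈ Metric.closedBall t ε :=
    nhdsWithin_le_nhds (Metric.closedBall_mem_nhds t hε)
  refine intervalIntegral.tendsto_integral_filter_of_dominated_convergence (fun _ => A * B)
    ?_ ?_ (by simp) ?_
  · filter_upwards [hball] with s hs
    have hc : ContinuousOn (fun x => a x s * ((s - t)⁻¹ * (b x s - b x t))) (Icc 0 y) :=
      (slice ha s (hεJ hs)).mul
        (continuousOn_const.mul ((slice hb s (hεJ hs)).sub (slice hb t (hεJ htJ))))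
    rw [uIoc_of_le hy]
    exact (hc.mono Ioc_subset_Icc_self).aestronglyMeasurable measurableSet_Ioc
  · filter_upwards [hball] with s hs
    have hne : ∀ᵐ x ∂(volume : Measure ℝ), x ≠ y := by simp [ae_iff, measure_singleton]
    filter_upwards [hne] with x hxy hx
    rw [uIoc_of_le hy] at hx
    have hx' : x ∈ Icc 0 y := ⟨hx.1.le, hx.2⟩
    have hxo : x ∈ Ioo 0 y := ⟨hx.1, lt_of_le_of_ne hx.2 hxy⟩
    have hA' := hA (x, s) ⟨hx', hs⟩
    have hmv : ‖b x s - b x t‖ ≤ B * ‖s - t‖ := by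
      refine (convex_closedBall t ε).norm_image_sub_le_of_norm_hasDerivWithin_le
        (f := fun r => b x r) (f' := fun r => b' x r)
        (fun r hr => (hd x hxo r (hεJ hr)).hasDerivWithinAt)
        (fun r hr => hB (x, r) ⟨hx', hr⟩) htJ hs
    have hq : ‖(s - t)⁻¹ * (b x s - b x t)‖ ≤ B := by
      rw [norm_mul, norm_inv]
      rcases eq_or_ne s t with h | h
      · subst h
        simp only [sub_self, norm_zero, mul_zero]
        exact (norm_nonneg _).trans (hB (x, s) ⟨hx', hs⟩)
      · have : 0 < ‖s - t‖ := norm_pos_iff.2 (sub_ne_zero.2 h)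
        rw [inv_mul_le_iff₀ this]; linarith
    rw [norm_mul]
    exact mul_le_mul hA' hq (norm_nonneg _) ((norm_nonneg _).trans hA')
  · have hne : ∀ᵐ x ∂(volume : Measure ℝ), x ≠ y := by simp [ae_iff, measure_singleton]
    filter_upwards [hne] with x hxy hx
    rw [uIoc_of_le hy] at hx
    have hx' : x ∈ Icc 0 y := ⟨hx.1.le, hx.2⟩
    have hxo : x ∈ Ioo 0 y := ⟨hx.1, lt_of_le_of_ne hx.2 hxy⟩
    refine Tendsto.mul ?_ ?_
    · exact ((tslice ha x hx').continuousAt hJ).tendsto.mono_left nhdsWithin_le_nhds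
    · have := hasDerivAt_iff_tendsto_slope.1 (hd x hxo t (hεJ htJ))
      simpa only [slope_fun_def, smul_eq_mul, vsub_eq_sub] using this

/-- Differentiation under the integral sign. -/
lemma hasDerivAt_integral_param {b b' : ℝ → ℝ → ℝ} {y t : ℝ} {J : Set ℝ} (hy : 0 ≤ y)
    (hJ : J ∈ 𝓝 t)
    (hb : ContinuousOn (fun p : ℝ × ℝ => b p.1 p.2) (Icc 0 y ×ˢ J))
    (hb' : ContinuousOn (fun p : ℝ × ℝ => b' p.1 p.2) (Icc 0 y ×ˢ J))
    (hd : ∀ x ∈ Ioo 0 y, ∀ s ∈ J, HasDerivAt (fun r => b x r) (b' x s) s) :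
    HasDerivAt (fun s => ∫ x in (0 : ℝ)..y, b x s) (∫ x in (0 : ℝ)..y, b' x t) t := by
  have h := hasDerivAt_integral_mul_sub (a := fun _ _ => 1) hy hJ continuousOn_const hb hb' hd
  simp only [one_mul] at h
  refine (h.add_const (∫ x in (0 : ℝ)..y, b x t)).congr_of_eventuallyEq ?_
  have hi : ∀ s ∈ J, IntervalIntegrable (fun x => b x s) volume 0 y := by
    intro s hs
    refine ContinuousOn.intervalIntegrable ?_
    rw [uIcc_of_le hy]
    exact ContinuousOn.comp (g := fun p : ℝ × ℝ => b p.1 p.2) hb (f := fun x => (x, s))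
      (by fun_prop) fun _ hx => ⟨hx, hs⟩
  filter_upwards [hJ] with s hs
  rw [intervalIntegral.integral_sub (hi s hs) (hi t (mem_of_mem_nhds hJ)), sub_add_cancel]

/-- `y` is continuous on `[0,∞)` with derivative `y'` on `(0,∞)`. -/
structure TimeDeriv (y y' : ℝ → ℝ) : Prop where
  cont : ContinuousOn y (Ici 0)
  deriv : ∀ t, 0 < t → HasDerivAt y (y' t) t

namespace TimeDeriv

variable {y y' z z' : ℝ → ℝ}

lemma const (c : ℝ) : TimeDeriv (fun _ => c) fun _ => 0 :=
  ⟨continuousOn_const, fun t _ => hasDerivAt_const t c⟩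

lemma add (hy : TimeDeriv y y') (hz : TimeDeriv z z') :
    TimeDeriv (fun t => y t + z t) fun t => y' t + z' t :=
  ⟨hy.cont.add hz.cont, fun t ht => (hy.deriv t ht).add (hz.deriv t ht)⟩

lemma sub (hy : TimeDeriv y y') (hz : TimeDeriv z z') :
    TimeDeriv (fun t => y t - z t) fun t => y' t - z' t :=
  ⟨hy.cont.sub hz.cont, fun t ht => (hy.deriv t ht).sub (hz.deriv t ht)⟩

lemma const_mul (c : ℝ) (hy : TimeDeriv y y') :
    TimeDeriv (fun t => c * y t) fun t => c * y' t :=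
  ⟨continuousOn_const.mul hy.cont, fun t ht => (hy.deriv t ht).const_mul c⟩

lemma congr_deriv (hy : TimeDeriv y y') (h : ∀ t, 0 < t → y' t = z' t) : TimeDeriv y z' :=
  ⟨hy.cont, fun t ht => h t ht ▸ hy.deriv t ht⟩

lemma le_of_deriv_nonpos (hy : TimeDeriv y y') {T : ℝ} (hT : 0 ≤ T)
    (h : ∀ t ∈ Ioo 0 T, y' t ≤ 0) : y T ≤ y 0 := by
  have hanti : AntitoneOn y (Icc 0 T) := by
    refine antitoneOn_of_deriv_nonpos (convex_Icc 0 T) (hy.cont.mono Icc_subset_Ici_self) ?_ ?_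
    · rw [interior_Icc]
      exact fun t ht => (hy.deriv t ht.1).differentiableAt.differentiableWithinAt
    · rw [interior_Icc]
      intro t ht
      rw [(hy.deriv t ht.1).deriv]
      exact h t ht
  exact hanti ⟨le_rfl, hT⟩ ⟨hT, le_rfl⟩ hT

/-- Grönwall's inequality with damping, a bounded multiplicative perturbation `A`
and a bounded monotone forcing `B`. -/
lemma gronwall {A A' B B' : ℝ → ℝ} {l b T : ℝ} (hT : 0 ≤ T) (hl : 0 ≤ l) (hb : 0 ≤ b)
    (hy : TimeDeriv y y') (hA : TimeDeriv A A') (hB : TimeDeriv B B')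
    (y0 : 0 ≤ y 0) (A0 : ∀ t, 0 ≤ t → 0 ≤ A t) (B0 : ∀ t, 0 ≤ t → 0 ≤ B t)
    (B0' : ∀ t ∈ Ioo 0 T, 0 ≤ B' t)
    (h : ∀ t ∈ Ioo 0 T, y' t ≤ l * (b - y t) + A' t * y t + B' t) :
    y T ≤ exp (A T) * (y 0 + b + B T) := by
  have hf : TimeDeriv (fun t => exp (l * t) * (y t * exp (-A t) - B t - b))
      (fun t => exp (l * t) * (l * 1) * (y t * exp (-A t) - B t - b)
        + exp (l * t) * (y' t * exp (-A t) + y t * (exp (-A t) * (-A' t)) - B' t)) := by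
    refine ⟨?_, fun t ht => ?_⟩
    · exact (Continuous.continuousOn (by fun_prop)).mul
        (((hy.cont.mul hA.cont.neg.rexp).sub hB.cont).sub continuousOn_const)
    · exact (((hasDerivAt_id t).const_mul l).exp).mul
        ((((hy.deriv t ht).mul (hA.deriv t ht).neg.exp).sub (hB.deriv t ht)).sub_const b)
  have hle := hf.le_of_deriv_nonpos hT fun t ht => by
    have h1 := h t ht
    have h2 := A0 t ht.1.le
    have h3 := B0 t ht.1.le
    have h4 := B0' t ht
    have he : exp (-A t) ≤ 1 := exp_le_one_iff.2 (by linarith)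
    have he0 := exp_pos (-A t)
    have : l * (y t * exp (-A t) - B t - b)
        + (y' t * exp (-A t) + y t * (exp (-A t) * (-A' t)) - B' t) ≤ 0 := by
      have h5 : (y' t - A' t * y t) * exp (-A t) ≤ (l * (b - y t) + B' t) * exp (-A t) :=
        mul_le_mul_of_nonneg_right (by linarith) he0.le
      nlinarith [mul_nonneg (mul_nonneg hl hb) (sub_nonneg.2 he),
        mul_nonneg h4 (sub_nonneg.2 he), mul_nonneg hl h3]
    have he2 := exp_pos (l * t)
    nlinarith
  simp only [mul_zero, exp_zero, one_mul] at hle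
  have hA0 := A0 0 le_rfl
  have hB0 := B0 0 le_rfl
  have e0 : exp (-A 0) ≤ 1 := exp_le_one_iff.2 (by linarith)
  have h0 : exp (l * T) * (y T * exp (-A T) - B T - b) ≤ y 0 := by
    nlinarith [mul_nonneg y0 (sub_nonneg.2 e0)]
  have e1 : 1 ≤ exp (l * T) := one_le_exp (by positivity)
  have h1 : y T * exp (-A T) - B T - b ≤ y 0 := by
    by_contra hcon
    push Not at hcon
    nlinarith
  have e2 : exp (A T) * exp (-A T) = 1 := by rw [← exp_add]; simp
  have e3 := exp_pos (A T)
  calc y T = exp (A T) * (y T * exp (-A T)) := by rw [mul_left_comm, e2, mul_one]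
    _ ≤ exp (A T) * (y 0 + b + B T) := by gcongr; linarith

end TimeDeriv

lemma ContRect.timeDeriv_integral {F F' : ℝ → ℝ → ℝ} (hF : ContRect F) (hF' : ContRect F')
    (hd : ∀ x ∈ Ioo (0 : ℝ) 1, ∀ t, 0 < t → HasDerivAt (fun s => F x s) (F' x t) t) :
    TimeDeriv (fun t => ∫ x in (0 : ℝ)..1, F x t) fun t => ∫ x in (0 : ℝ)..1, F' x t :=
  ⟨hF.continuousOn_integral, fun _ ht =>
    hasDerivAt_integral_param zero_le_one (Ioi_mem_nhds ht)
      (ContinuousOn.mono hF (prod_mono_right Ioi_subset_Ici_self))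
      (ContinuousOn.mono hF' (prod_mono_right Ioi_subset_Ici_self)) hd⟩

lemma TimeDeriv.eq_zero_of_deriv_eq_zero {y : ℝ → ℝ} (hy : TimeDeriv y fun _ => 0) {t : ℝ}
    (ht : 0 ≤ t) : y t = y 0 := by
  have h1 := hy.le_of_deriv_nonpos ht fun _ _ => le_rfl
  have h2 := (hy.const_mul (-1)).le_of_deriv_nonpos ht fun _ _ => by simp
  linarith

namespace NSSol

variable (S : NSSol)

/-- The effective stress `(v_x - θ)/u`. -/
noncomputable def stress (x t : ℝ) : ℝ := (S.vx x t - S.θ x t) / S.u x t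

/-- The heat flux `θ^β θ_x / u`. -/
noncomputable def flux (x t : ℝ) : ℝ := S.θ x t ^ S.β * S.θx x t / S.u x t

/-- The velocity potential `∫₀ˣ v dξ`. -/
noncomputable def potential (x t : ℝ) : ℝ := ∫ ξ in (0 : ℝ)..x, S.v ξ t

/-- The weighted specific volume `exp(-∫₀ˣ v) u`. -/
noncomputable def wvol (x t : ℝ) : ℝ := exp (-S.potential x t) * S.u x t

/-- The entropy functional `∫₀¹ (log θ - (1 - x) v) dx`. -/
noncomputable def entropy (t : ℝ) : ℝ :=
  ∫ x in (0 : ℝ)..1, (log (S.θ x t) - (1 - x) * S.v x t)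

/-- The entropy production up to time `t`, that is, `∫₀ᵗ V`. -/
noncomputable def cumV (t : ℝ) : ℝ := S.entropy t - S.entropy 0

/-- The integrand of `V`. -/
noncomputable def dissip (x t : ℝ) : ℝ :=
  S.θ x t ^ S.β * (S.θx x t) ^ 2 / (S.u x t * (S.θ x t) ^ 2)
      + (S.vx x t - S.θ x t) ^ 2 / (S.u x t * S.θ x t)

lemma cu : ContRect S.u := S.hu_cont
lemma cv : ContRect S.v := S.hv_cont
lemma ct : ContRect S.θ := S.hθ_cont
lemma cux : ContRect S.ux := S.hux_cont
lemma cut : ContRect S.ut := S.hut_cont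
lemma cvx : ContRect S.vx := S.hvx_cont
lemma cvt : ContRect S.vt := S.hvt_cont
lemma ctx : ContRect S.θx := S.hθx_cont
lemma ctt : ContRect S.θt := S.hθt_cont

lemma crpow (a : ℝ) : ContRect fun x t => S.θ x t ^ a := S.ct.rpow S.hθ_pos a

lemma cstress : ContRect S.stress := (S.cvx.sub S.ct).div S.cu S.hu_pos

lemma cflux : ContRect S.flux := ((S.crpow S.β).mul S.ctx).div S.cu S.hu_pos

lemma cpotential : ContRect S.potential := S.cv.primitive

lemma cwvol : ContRect S.wvol := S.cpotential.neg.exp.mul S.cu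

lemma cdissip : ContRect S.dissip := by
  refine ((((S.crpow S.β).mul (S.ctx.pow 2)).div (S.cu.mul (S.ct.pow 2)) ?_)).add
    (((S.cvx.sub S.ct).pow 2).div (S.cu.mul S.ct) ?_)
  · intro x hx t ht
    exact mul_pos (S.hu_pos x hx t ht) (pow_pos (S.hθ_pos x hx t ht) 2)
  · intro x hx t ht
    exact mul_pos (S.hu_pos x hx t ht) (S.hθ_pos x hx t ht)

variable {S}

lemma hasDerivAt_u {x t : ℝ} (hx : x ∈ Icc (0 : ℝ) 1) (ht : 0 < t) :
    HasDerivAt (fun s => S.u x s) (S.ut x t) t :=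
  (S.hut x hx t ht.le).hasDerivAt (Ici_mem_nhds ht)

lemma hasDerivAt_v {x t : ℝ} (hx : x ∈ Icc (0 : ℝ) 1) (ht : 0 < t) :
    HasDerivAt (fun s => S.v x s) (S.vt x t) t :=
  (S.hvt x hx t ht.le).hasDerivAt (Ici_mem_nhds ht)

lemma hasDerivAt_θ {x t : ℝ} (hx : x ∈ Icc (0 : ℝ) 1) (ht : 0 < t) :
    HasDerivAt (fun s => S.θ x s) (S.θt x t) t :=
  (S.hθt x hx t ht.le).hasDerivAt (Ici_mem_nhds ht)

lemma hasDerivWithinAt_stress {x t : ℝ} (hx : x ∈ Icc (0 : ℝ) 1) (ht : 0 ≤ t) :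
    HasDerivWithinAt (fun y => S.stress y t) (S.vt x t) (Icc 0 1) x :=
  S.momentum x hx t ht

lemma hasDerivWithinAt_flux {x t : ℝ} (hx : x ∈ Icc (0 : ℝ) 1) (ht : 0 ≤ t) :
    HasDerivWithinAt (fun y => S.flux y t) (S.θt x t - S.stress x t * S.vx x t) (Icc 0 1) x := by
  refine (S.energyEq x hx t ht).congr_deriv ?_
  have := (S.hu_pos x hx t ht).ne'
  unfold stress
  field_simp
  ring

lemma hasDerivWithinAt_rpow (a : ℝ) {x t : ℝ} (hx : x ∈ Icc (0 : ℝ) 1) (ht : 0 ≤ t) :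
    HasDerivWithinAt (fun y => S.θ y t ^ a) (a * S.θ x t ^ (a - 1) * S.θx x t) (Icc 0 1) x := by
  refine ((S.hθx x hx t ht).rpow_const (Or.inl (S.hθ_pos x hx t ht).ne')).congr_deriv ?_
  ring

lemma stress_zero {t : ℝ} (ht : 0 ≤ t) : S.stress 0 t = 0 := S.bc0 t ht
lemma stress_one {t : ℝ} (ht : 0 ≤ t) : S.stress 1 t = 0 := S.bc1 t ht
lemma flux_zero {t : ℝ} (ht : 0 ≤ t) : S.flux 0 t = 0 := by simp [flux, S.bcθ0 t ht]
lemma flux_one {t : ℝ} (ht : 0 ≤ t) : S.flux 1 t = 0 := by simp [flux, S.bcθ1 t ht]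

lemma vx_eq {x t : ℝ} (hx : x ∈ Icc (0 : ℝ) 1) (ht : 0 ≤ t) :
    S.vx x t = S.u x t * S.stress x t + S.θ x t := by
  have := (S.hu_pos x hx t ht).ne'
  unfold stress
  field_simp
  ring

/-! ### Energy -/

lemma energy_eq {t : ℝ} (ht : 0 ≤ t) :
    ∫ x in (0 : ℝ)..1, ((S.v x t) ^ 2 / 2 + S.θ x t) = S.E₀ := by
  have h := ContRect.timeDeriv_integral (F := fun x t => S.v x t ^ 2 / 2 + S.θ x t)
    (F' := fun x t => S.v x t * S.vt x t + S.θt x t)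
    (((S.cv.pow 2).div (ContRect.const 2) (by simp)).add S.ct)
    ((S.cv.mul S.cvt).add S.ctt) fun x hx t ht => by
      have hx' := Ioo_subset_Icc_self hx
      refine ((((hasDerivAt_v hx' ht).pow 2).div_const 2).add (hasDerivAt_θ hx' ht)).congr_deriv ?_
      push_cast
      ring
  refine (h.congr_deriv (z' := fun _ => 0) fun s hs => ?_).eq_zero_of_deriv_eq_zero ht
  have := integral_unit_eq_of_deriv
    (g := fun x => S.v x s * S.stress x s + S.flux x s)
    (f₁ := fun x => S.v x s * S.vt x s + S.θt x s) (f₂ := fun _ => 0) (fun x hx => by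
      refine (((S.hvx x hx s hs.le).mul (hasDerivWithinAt_stress hx hs.le)).add
        (hasDerivWithinAt_flux hx hs.le)).congr_deriv ?_
      ring) (((S.cv.mul S.cvt).add S.ctt).slice hs.le) continuousOn_const
    (by simp [stress_zero hs.le, flux_zero hs.le]) (by simp [stress_one hs.le, flux_one hs.le])
  rw [this]
  simp

lemma integral_θ_le {t : ℝ} (ht : 0 ≤ t) : ∫ x in (0 : ℝ)..1, S.θ x t ≤ S.E₀ := by
  rw [← energy_eq ht]
  refine integral_unit_mono (S.ct.slice ht)
    ((((S.cv.pow 2).div (ContRect.const 2) (by simp)).add S.ct).slice ht) fun x _ => ?_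
  have := sq_nonneg (S.v x t)
  linarith

lemma integral_v_sq_le {t : ℝ} (ht : 0 ≤ t) : ∫ x in (0 : ℝ)..1, S.v x t ^ 2 ≤ 2 * S.E₀ := by
  have h := integral_unit_le_comb 2 0 0 ((S.cv.pow 2).slice ht)
    ((((S.cv.pow 2).div (ContRect.const 2) (by simp)).add S.ct).slice ht)
    (continuousOn_const (c := (0 : ℝ))) (continuousOn_const (c := (0 : ℝ))) fun x hx => by
      have := S.hθ_pos x hx t ht
      linarith
  rw [energy_eq ht] at h
  linarith

lemma E₀_pos : 0 < S.E₀ := by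
  obtain ⟨x, hx, h⟩ := exists_le_integral_unit (S.ct.slice le_rfl)
  exact (S.hθ_pos x hx 0 self_mem_Ici).trans_le (h.trans (integral_θ_le le_rfl))

lemma integral_abs_v_le {t : ℝ} (ht : 0 ≤ t) :
    ∫ x in (0 : ℝ)..1, |S.v x t| ≤ 1 / 2 + S.E₀ := by
  have h := integral_unit_le_comb (1 / 2) (1 / 2) 0 (S.cv.abs.slice ht)
    ((S.cv.pow 2).slice ht) (continuousOn_const (c := (1 : ℝ)))
    (continuousOn_const (c := (0 : ℝ))) fun x hx => by
      have := sq_nonneg (|S.v x t| - 1)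
      have := sq_abs (S.v x t)
      nlinarith
  rw [integral_unit_const] at h
  linarith [integral_v_sq_le (S := S) ht]

lemma abs_potential_le {x t : ℝ} (hx : x ∈ Icc (0 : ℝ) 1) (ht : 0 ≤ t) :
    |S.potential x t| ≤ 1 / 2 + S.E₀ := by
  refine le_trans ?_ (integral_abs_v_le ht)
  refine (intervalIntegral.abs_integral_le_integral_abs hx.1).trans ?_
  exact intervalIntegral.integral_mono_interval le_rfl hx.1 hx.2
    (Eventually.of_forall fun z => abs_nonneg _) (S.cv.abs.slice ht).intervalIntegrable_unit

lemma stress_sq_le {x t : ℝ} (hx : x ∈ Icc (0 : ℝ) 1) (ht : 0 ≤ t) :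
    S.stress x t ^ 2 ≤ ∫ y in (0 : ℝ)..1, S.vt y t ^ 2 := by
  have h := abs_sub_le_integral_abs_deriv (g := fun y => S.stress y t)
    (fun y hy => hasDerivWithinAt_stress hy ht) (S.cvt.slice ht) hx
    (y := 0) ⟨le_rfl, zero_le_one⟩
  rw [stress_zero ht, sub_zero] at h
  have h2 := sq_integral_mul_le (S.cvt.abs.slice ht) (continuousOn_const (c := (1 : ℝ)))
  simp only [mul_one, one_pow, integral_unit_const, sq_abs] at h2
  rw [← sq_abs]
  exact (pow_le_pow_left₀ (abs_nonneg _) h 2).trans h2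

/-! ### Entropy -/

lemma V_eq (t : ℝ) : S.V t = ∫ x in (0 : ℝ)..1, S.dissip x t := rfl

lemma dissip_nonneg {x t : ℝ} (hx : x ∈ Icc (0 : ℝ) 1) (ht : 0 ≤ t) : 0 ≤ S.dissip x t := by
  have := S.hu_pos x hx t ht
  have := S.hθ_pos x hx t ht
  unfold dissip
  positivity

lemma V_nonneg {t : ℝ} (ht : 0 ≤ t) : 0 ≤ S.V t :=
  integral_unit_nonneg fun _ hx => dissip_nonneg hx ht

lemma timeDeriv_cumV : TimeDeriv S.cumV S.V := by
  have clin : ContRect fun x _ => 1 - x := (ContRect.const 1).sub ContRect.fst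
  have h := ContRect.timeDeriv_integral (F := fun x t => log (S.θ x t) - (1 - x) * S.v x t)
    (F' := fun x t => S.θt x t / S.θ x t - (1 - x) * S.vt x t)
    ((S.ct.log S.hθ_pos).sub (clin.mul S.cv))
    ((S.ctt.div S.ct S.hθ_pos).sub (clin.mul S.cvt)) fun x hx t ht => by
      have hx' := Ioo_subset_Icc_self hx
      exact ((hasDerivAt_θ hx' ht).log (S.hθ_pos x hx' t ht.le).ne').sub
        ((hasDerivAt_v hx' ht).const_mul _)
  refine ((h.sub (TimeDeriv.const (S.entropy 0))).congr_deriv (z' := S.V) fun t ht => ?_)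
  rw [sub_zero, V_eq]
  refine integral_unit_eq_of_deriv
    (g := fun x => S.flux x t / S.θ x t - (1 - x) * S.stress x t) (fun x hx => ?_)
    (((S.ctt.div S.ct S.hθ_pos).sub (clin.mul S.cvt)).slice ht.le) (S.cdissip.slice ht.le)
    (by simp [stress_zero ht.le, flux_zero ht.le]) (by simp [stress_one ht.le, flux_one ht.le])
  have hθ := (S.hθ_pos x hx t ht.le).ne'
  have hu := (S.hu_pos x hx t ht.le).ne'
  refine (((hasDerivWithinAt_flux hx ht.le).div (S.hθx x hx t ht.le) hθ).sub
    ((((hasDerivWithinAt_id x _).const_sub 1)).mul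
      (hasDerivWithinAt_stress hx ht.le))).congr_deriv ?_
  unfold dissip flux stress
  simp only [id]
  field_simp
  ring

lemma cumV_zero : S.cumV 0 = 0 := sub_self _

lemma cumV_nonneg {t : ℝ} (ht : 0 ≤ t) : 0 ≤ S.cumV t := by
  have := (timeDeriv_cumV (S := S).const_mul (-1)).le_of_deriv_nonpos ht fun s hs => by
    have := V_nonneg (S := S) hs.1.le
    linarith
  rw [cumV_zero] at this
  linarith

lemma abs_moment_le {x t : ℝ} (hx : x ∈ Icc (0 : ℝ) 1) : |(1 - x) * S.v x t| ≤ |S.v x t| := by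
  rw [abs_mul, abs_of_nonneg (sub_nonneg.2 hx.2)]
  have := hx.1
  nlinarith [abs_nonneg (S.v x t)]

lemma exists_cumV_le : ∃ C > 0, ∀ t, 0 ≤ t → S.cumV t ≤ C := by
  refine ⟨S.E₀ + (1 / 2 + S.E₀) + |S.entropy 0|, ?_, fun t ht => ?_⟩
  · have := E₀_pos (S := S)
    positivity
  have h := integral_unit_le_comb 1 1 0
    (((S.ct.log S.hθ_pos).sub (((ContRect.const 1).sub ContRect.fst).mul S.cv)).slice ht)
    (S.ct.slice ht) (S.cv.abs.slice ht) (continuousOn_const (c := (0 : ℝ))) fun x hx => by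
      have h1 := log_le_sub_one_of_pos (S.hθ_pos x hx t ht)
      have h2 := neg_le_of_abs_le (abs_moment_le (S := S) (t := t) hx)
      linarith
  have h' : S.entropy t ≤ 1 * (∫ x in (0 : ℝ)..1, S.θ x t) + 1 * (∫ x in (0 : ℝ)..1, |S.v x t|)
    + 0 * ∫ _ in (0 : ℝ)..1, (0 : ℝ) := h
  have := integral_θ_le (S := S) ht
  have := integral_abs_v_le (S := S) ht
  have := neg_abs_le (S.entropy 0)
  unfold cumV
  linarith

lemma exists_θ_ge : ∃ c > 0, ∀ t, 0 ≤ t → ∃ x ∈ Icc (0 : ℝ) 1, c ≤ S.θ x t := by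
  refine ⟨exp (S.entropy 0 - (1 / 2 + S.E₀)), exp_pos _, fun t ht => ?_⟩
  obtain ⟨x, hx, hm⟩ := exists_integral_unit_le ((S.ct.log S.hθ_pos).slice ht)
  refine ⟨x, hx, ?_⟩
  rw [← le_log_iff_exp_le (S.hθ_pos x hx t ht)]
  refine le_trans ?_ hm
  have h := integral_unit_le_comb 1 1 0
    (((S.ct.log S.hθ_pos).sub (((ContRect.const 1).sub ContRect.fst).mul S.cv)).slice ht)
    ((S.ct.log S.hθ_pos).slice ht) (S.cv.abs.slice ht)
    (continuousOn_const (c := (0 : ℝ))) fun x hx => by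
      have h2 := neg_le_of_abs_le (abs_moment_le (S := S) (t := t) hx)
      linarith
  have h' : S.entropy t ≤ 1 * (∫ x in (0 : ℝ)..1, log (S.θ x t))
    + 1 * (∫ x in (0 : ℝ)..1, |S.v x t|) + 0 * ∫ _ in (0 : ℝ)..1, (0 : ℝ) := h
  have := integral_abs_v_le (S := S) ht
  have h3 := cumV_nonneg (S := S) ht
  unfold cumV at h3
  linarith

lemma exists_θ_le {t : ℝ} (ht : 0 ≤ t) : ∃ x ∈ Icc (0 : ℝ) 1, S.θ x t ≤ S.E₀ := by
  obtain ⟨x, hx, hm⟩ := exists_le_integral_unit (S.ct.slice ht)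
  exact ⟨x, hx, hm.trans (integral_θ_le ht)⟩

/-- The oscillation of powers of the temperature is controlled by the entropy production. -/
lemma sq_rpow_sub_le (a : ℝ) {x y t : ℝ} (hx : x ∈ Icc (0 : ℝ) 1) (hy : y ∈ Icc (0 : ℝ) 1)
    (ht : 0 ≤ t) :
    (S.θ x t ^ a - S.θ y t ^ a) ^ 2
      ≤ a ^ 2 * (S.V t * ∫ z in (0 : ℝ)..1, S.u z t * S.θ z t ^ (2 * a - S.β)) := by
  have cw : ContRect fun x t => S.u x t * S.θ x t ^ (2 * a - S.β) := S.cu.mul (S.crpow _)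
  have hwpos : ∀ z ∈ Icc (0 : ℝ) 1, 0 < S.u z t * S.θ z t ^ (2 * a - S.β) := fun z hz =>
    mul_pos (S.hu_pos z hz t ht) (rpow_pos_of_pos (S.hθ_pos z hz t ht) _)
  have hD : ∀ z ∈ Icc (0 : ℝ) 1, (S.θ z t ^ (a - 1) * S.θx z t) ^ 2
      ≤ S.dissip z t * (S.u z t * S.θ z t ^ (2 * a - S.β)) := by
    intro z hz
    have hu := S.hu_pos z hz t ht
    have hθ := S.hθ_pos z hz t ht
    have h1 : (S.θ z t ^ (a - 1) * S.θx z t) ^ 2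
        = S.θ z t ^ S.β * (S.θx z t) ^ 2 / (S.u z t * (S.θ z t) ^ 2)
          * (S.u z t * S.θ z t ^ (2 * a - S.β)) := by
      rw [mul_pow, ← rpow_natCast (S.θ z t ^ (a - 1)), ← rpow_mul hθ.le]
      have : S.θ z t ^ ((a - 1) * ((2 : ℕ) : ℝ)) * S.θ z t ^ 2
          = S.θ z t ^ S.β * S.θ z t ^ (2 * a - S.β) := by
        rw [← rpow_natCast (S.θ z t) 2, ← rpow_add hθ, ← rpow_add hθ]
        congr 1; push_cast; ring
      generalize S.θ z t ^ (2 * a - S.β) = p at this ⊢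
      generalize S.θ z t ^ ((a - 1) * ((2 : ℕ) : ℝ)) = q at this ⊢
      field_simp
      linear_combination (S.θx z t ^ 2) * this
    rw [h1]
    refine mul_le_mul_of_nonneg_right ?_ (hwpos z hz).le
    unfold dissip
    have : 0 ≤ (S.vx z t - S.θ z t) ^ 2 / (S.u z t * S.θ z t) := by positivity
    linarith
  have hcd : ContRect fun x t => a * S.θ x t ^ (a - 1) * S.θx x t :=
    ((ContRect.const a).mul (S.crpow _)).mul S.ctx
  have h1 := abs_sub_le_integral_abs_deriv (g := fun y => S.θ y t ^ a)
    (fun z hz => hasDerivWithinAt_rpow a hz ht) (hcd.slice ht) hx hy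
  have h2 := integral_unit_le_comb |a| 0 0 (hcd.abs.slice ht)
    (f₁ := fun z => √(S.dissip z t) * √(S.u z t * S.θ z t ^ (2 * a - S.β)))
    ((S.cdissip.slice ht).sqrt.mul (cw.slice ht).sqrt) (continuousOn_const (c := (0 : ℝ)))
    (continuousOn_const (c := (0 : ℝ))) fun z hz => by
      simp only [mul_zero, add_zero]
      rw [mul_assoc, abs_mul]
      refine mul_le_mul_of_nonneg_left ?_ (abs_nonneg a)
      rw [← sqrt_mul (dissip_nonneg hz ht)]
      exact abs_le_sqrt (hD z hz)
  have h3 := sq_integral_mul_le (S.cdissip.slice ht).sqrt (cw.slice ht).sqrt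
  have e1 : ∫ z in (0 : ℝ)..1, √(S.dissip z t) ^ 2 = S.V t := by
    rw [V_eq]
    refine intervalIntegral.integral_congr fun z hz => ?_
    rw [uIcc_of_le zero_le_one] at hz
    exact sq_sqrt (dissip_nonneg hz ht)
  have e2 : ∫ z in (0 : ℝ)..1, √(S.u z t * S.θ z t ^ (2 * a - S.β)) ^ 2
      = ∫ z in (0 : ℝ)..1, S.u z t * S.θ z t ^ (2 * a - S.β) := by
    refine intervalIntegral.integral_congr fun z hz => ?_
    rw [uIcc_of_le zero_le_one] at hz
    exact sq_sqrt (hwpos z hz).le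
  rw [e1, e2] at h3
  simp only [zero_mul, add_zero] at h2
  calc (S.θ x t ^ a - S.θ y t ^ a) ^ 2 = |S.θ x t ^ a - S.θ y t ^ a| ^ 2 := (sq_abs _).symm
    _ ≤ (|a| * ∫ z in (0 : ℝ)..1,
          √(S.dissip z t) * √(S.u z t * S.θ z t ^ (2 * a - S.β))) ^ 2 :=
        pow_le_pow_left₀ (abs_nonneg _) (h1.trans h2) 2
    _ = a ^ 2 * (∫ z in (0 : ℝ)..1,
          √(S.dissip z t) * √(S.u z t * S.θ z t ^ (2 * a - S.β))) ^ 2 := by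
        rw [mul_pow, sq_abs]
    _ ≤ _ := mul_le_mul_of_nonneg_left h3 (sq_nonneg a)

end NSSol

lemma ContRect.exists_initial_bound {F : ℝ → ℝ → ℝ} (hF : ContRect F) :
    ∃ C > 0, ∀ x ∈ Icc (0 : ℝ) 1, F x 0 ≤ C := by
  obtain ⟨C, hC⟩ := isCompact_Icc.exists_bound_of_continuousOn (hF.slice le_rfl)
  refine ⟨|C| + 1, by positivity, fun x hx => ?_⟩
  have h1 := hC x hx
  have h2 := le_abs_self (F x 0)
  have h3 := le_abs_self C
  rw [norm_eq_abs] at h1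
  linarith

namespace NSSol

variable {S : NSSol}

/-! ### Bounds for the specific volume -/

lemma hasDerivAt_potential {x t : ℝ} (hx : x ∈ Icc (0 : ℝ) 1) (ht : 0 < t) :
    HasDerivAt (fun s => S.potential x s) (S.stress x t) t := by
  have hsub : Icc 0 x ×ˢ Ioi (0 : ℝ) ⊆ Icc 0 1 ×ˢ Ici 0 :=
    prod_mono (Icc_subset_Icc_right hx.2) Ioi_subset_Ici_self
  have h := hasDerivAt_integral_param (b := S.v) (b' := S.vt) hx.1 (Ioi_mem_nhds ht)
    (ContinuousOn.mono S.cv hsub) (ContinuousOn.mono S.cvt hsub)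
    fun y hy s hs => hasDerivAt_v ⟨hy.1.le, hy.2.le.trans hx.2⟩ hs
  rwa [integral_eq_sub_of_hasDerivWithinAt_unit (g := fun y => S.stress y t)
    (fun y hy => hasDerivWithinAt_stress hy ht.le) (S.cvt.slice ht.le) hx, stress_zero ht.le,
    sub_zero] at h

lemma timeDeriv_wvol {x : ℝ} (hx : x ∈ Icc (0 : ℝ) 1) :
    TimeDeriv (S.wvol x) fun t => exp (-S.potential x t) * (S.θ x t - S.u x t) := by
  refine ⟨S.cwvol.timeSlice hx, fun t ht => ?_⟩
  refine ((hasDerivAt_potential hx ht).neg.exp.mul (hasDerivAt_u hx ht)).congr_deriv ?_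
  have h1 := S.mass x hx t ht.le
  have h2 := vx_eq (S := S) hx ht.le
  linear_combination exp (-S.potential x t) * (h1 + h2)

lemma exp_neg_potential_le {x t : ℝ} (hx : x ∈ Icc (0 : ℝ) 1) (ht : 0 ≤ t) :
    exp (-S.potential x t) ≤ exp (1 / 2 + S.E₀) :=
  exp_le_exp.2 (by linarith [neg_le_of_abs_le (abs_potential_le (S := S) hx ht)])

lemma one_le_mul_exp_neg_potential {x t : ℝ} (hx : x ∈ Icc (0 : ℝ) 1) (ht : 0 ≤ t) :
    1 ≤ exp (1 / 2 + S.E₀) * exp (-S.potential x t) := by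
  rw [← exp_add]
  exact one_le_exp (by linarith [le_of_abs_le (abs_potential_le (S := S) hx ht)])

lemma wvol_pos {x t : ℝ} (hx : x ∈ Icc (0 : ℝ) 1) (ht : 0 ≤ t) : 0 < S.wvol x t :=
  mul_pos (exp_pos _) (S.hu_pos x hx t ht)

lemma u_le_wvol {x t : ℝ} (hx : x ∈ Icc (0 : ℝ) 1) (ht : 0 ≤ t) :
    S.u x t ≤ exp (1 / 2 + S.E₀) * S.wvol x t := by
  have h := mul_le_mul_of_nonneg_right (one_le_mul_exp_neg_potential (S := S) hx ht)
    (S.hu_pos x hx t ht).le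
  unfold wvol
  linarith

lemma wvol_le_u {x t : ℝ} (hx : x ∈ Icc (0 : ℝ) 1) (ht : 0 ≤ t) :
    S.wvol x t ≤ exp (1 / 2 + S.E₀) * S.u x t :=
  mul_le_mul_of_nonneg_right (exp_neg_potential_le hx ht) (S.hu_pos x hx t ht).le

lemma exists_integral_u_le : ∃ C > 0, ∀ t, 0 ≤ t → ∫ x in (0 : ℝ)..1, S.u x t ≤ C := by
  have hE := E₀_pos (S := S)
  set K := exp (1 / 2 + S.E₀) with hK
  have hK0 : 0 < K := exp_pos _
  have cd : ContRect fun x t => exp (-S.potential x t) * (S.θ x t - S.u x t) :=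
    S.cpotential.neg.exp.mul (S.ct.sub S.cu)
  have h := ContRect.timeDeriv_integral S.cwvol cd fun x hx t ht =>
    (timeDeriv_wvol (Ioo_subset_Icc_self hx)).deriv t ht
  have hw0 : 0 ≤ ∫ x in (0 : ℝ)..1, S.wvol x 0 :=
    integral_unit_nonneg fun x hx => (wvol_pos hx le_rfl).le
  refine ⟨K * ((∫ x in (0 : ℝ)..1, S.wvol x 0) + K * S.E₀), by positivity, fun t ht => ?_⟩
  have hg := h.gronwall (l := 1) (b := K * S.E₀) ht zero_le_one (by positivity)
    (TimeDeriv.const 0) (TimeDeriv.const 0) hw0 (fun _ _ => le_rfl) (fun _ _ => le_rfl)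
    (fun _ _ => le_rfl) fun s hs => by
      have h1 := integral_unit_le_comb K (-1) 0 (cd.slice hs.1.le) (S.ct.slice hs.1.le)
        (S.cwvol.slice hs.1.le) (continuousOn_const (c := (0 : ℝ))) fun x hx => by
          have := mul_le_mul_of_nonneg_right (exp_neg_potential_le (S := S) hx hs.1.le)
            (S.hθ_pos x hx s hs.1.le).le
          unfold wvol
          linarith
      have h2 := mul_le_mul_of_nonneg_left (integral_θ_le (S := S) hs.1.le) hK0.le
      linarith
  rw [exp_zero] at hg
  have h3 := integral_unit_le_comb K 0 0 (S.cu.slice ht) (S.cwvol.slice ht)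
    (continuousOn_const (c := (0 : ℝ))) (continuousOn_const (c := (0 : ℝ))) fun x hx => by
      linarith [u_le_wvol (S := S) hx ht]
  have h4 := mul_le_mul_of_nonneg_left hg hK0.le
  linarith

lemma rpow_half_sq {a b : ℝ} (ha : 0 < a) : (a ^ (b / 2)) ^ 2 = a ^ b := by
  rw [← rpow_natCast, ← rpow_mul ha.le]
  congr 1
  push_cast
  ring

lemma rpow_le_one_add_rpow {a p q : ℝ} (ha : 0 < a) (hp : 0 ≤ p) (hpq : p ≤ q) :
    a ^ p ≤ 1 + a ^ q := by
  rcases le_total a 1 with h | h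
  · have := rpow_le_one ha.le h hp
    have := rpow_pos_of_pos ha q
    linarith
  · have := rpow_le_rpow_of_exponent_le h hpq
    linarith

lemma exists_θ_le_of_u_le : ∃ C > 0, ∀ t, 0 ≤ t → ∀ B, 0 ≤ B →
    (∀ y ∈ Icc (0 : ℝ) 1, S.u y t ≤ B) →
    ∀ x ∈ Icc (0 : ℝ) 1, S.θ x t ≤ C * (1 + S.V t * (1 + B)) := by
  have hE := E₀_pos (S := S)
  have hβ := S.hβ
  rcases le_or_gt 1 S.β with h1 | h1
  · obtain ⟨Cu, hCu, hu⟩ := exists_integral_u_le (S := S)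
    have hEβ := rpow_pos_of_pos hE S.β
    refine ⟨1 + 2 * S.E₀ ^ S.β + 2 * ((S.β / 2) ^ 2 * Cu), by positivity,
      fun t ht B hB _ x hx => ?_⟩
    obtain ⟨y, hy, hyE⟩ := exists_θ_le (S := S) ht
    have hV := V_nonneg (S := S) ht
    have hθ := S.hθ_pos x hx t ht
    have hθy := S.hθ_pos y hy t ht
    have h := sq_rpow_sub_le (S := S) (S.β / 2) hx hy ht
    have e : 2 * (S.β / 2) - S.β = 0 := by ring
    simp only [e, rpow_zero, mul_one] at h
    have h2 := mul_le_mul_of_nonneg_left (mul_le_mul_of_nonneg_left (hu t ht) hV)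
      (sq_nonneg (S.β / 2))
    have h3 : S.θ y t ^ S.β ≤ S.E₀ ^ S.β := rpow_le_rpow hθy.le hyE hβ.le
    have h4 := rpow_half_sq (b := S.β) hθ
    have h5 := rpow_half_sq (b := S.β) hθy
    have h6 := rpow_le_one_add_rpow hθ zero_le_one h1
    rw [rpow_one] at h6
    have h7 : S.θ x t ^ S.β ≤ 2 * S.E₀ ^ S.β + 2 * ((S.β / 2) ^ 2 * (S.V t * Cu)) := by
      nlinarith [sq_nonneg (S.θ x t ^ (S.β / 2) - 2 * S.θ y t ^ (S.β / 2))]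
    have h8 : 0 ≤ S.V t * B := mul_nonneg hV hB
    have h9 : 0 ≤ (S.β / 2) ^ 2 * Cu := by positivity
    have h10 := mul_nonneg h9 h8
    have h11 := mul_nonneg hEβ.le (add_nonneg hV h8)
    nlinarith
  · refine ⟨2 * S.E₀ + (1 + S.E₀), by positivity, fun t ht B hB hu x hx => ?_⟩
    obtain ⟨y, hy, hyE⟩ := exists_θ_le (S := S) ht
    have hV := V_nonneg (S := S) ht
    have hθ := S.hθ_pos x hx t ht
    have hθy := S.hθ_pos y hy t ht
    have h := sq_rpow_sub_le (S := S) (1 / 2) hx hy ht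
    have h2 := integral_unit_le_comb B B 0 ((S.cu.mul (S.crpow (2 * (1 / 2) - S.β))).slice ht)
      (continuousOn_const (c := (1 : ℝ))) (S.ct.slice ht) (continuousOn_const (c := (0 : ℝ)))
      fun z hz => by
        have hz1 := S.hθ_pos z hz t ht
        have h6 := rpow_le_one_add_rpow (p := 2 * (1 / 2) - S.β) (q := 1) hz1
          (by linarith) (by linarith)
        rw [rpow_one] at h6
        have := mul_le_mul (hu z hz) h6 (rpow_nonneg hz1.le _) hB
        linarith
    rw [integral_unit_const] at h2
    have h3 := mul_le_mul_of_nonneg_left (integral_θ_le (S := S) ht) hB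
    have h4 := rpow_half_sq (b := 1) hθ
    have h5 := rpow_half_sq (b := 1) hθy
    rw [rpow_one] at h4 h5
    have h7 : (S.θ x t ^ (1 / 2 : ℝ) - S.θ y t ^ (1 / 2 : ℝ)) ^ 2
        ≤ (1 / 2) ^ 2 * (S.V t * (B * (1 + S.E₀))) := by
      refine h.trans (mul_le_mul_of_nonneg_left (mul_le_mul_of_nonneg_left ?_ hV) (by positivity))
      linarith
    have h8 : S.θ x t ≤ 2 * S.E₀ + 2 * ((1 / 2) ^ 2 * (S.V t * (B * (1 + S.E₀)))) := by
      nlinarith [sq_nonneg (S.θ x t ^ (1 / 2 : ℝ) - 2 * S.θ y t ^ (1 / 2 : ℝ))]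
    have h9 : 0 ≤ S.V t * B := mul_nonneg hV hB
    have h10 := mul_nonneg hE.le h9
    have h11 := mul_nonneg hE.le hV
    nlinarith

lemma timeDeriv_exp_cumV (k : ℝ) :
    TimeDeriv (fun t => exp (k * S.cumV t)) fun t => exp (k * S.cumV t) * (k * S.V t) := by
  have h := timeDeriv_cumV (S := S)
  exact ⟨(h.const_mul k).cont.rexp, fun t ht => ((h.const_mul k).deriv t ht).exp⟩

lemma exists_u_le : ∃ C > 0, ∀ x ∈ Icc (0 : ℝ) 1, ∀ t, 0 ≤ t → S.u x t ≤ C := by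
  obtain ⟨C₁, hC₁, hθ⟩ := exists_θ_le_of_u_le (S := S)
  obtain ⟨N, hN, hVN⟩ := exists_cumV_le (S := S)
  obtain ⟨W, hW, hw0⟩ := S.cwvol.exists_initial_bound
  set K := exp (1 / 2 + S.E₀) with hK
  have hK0 : 0 < K := exp_pos _
  set c := K * C₁ with hc
  have hc0 : 0 < c := by positivity
  set k := 2 * (c * K) with hk
  have hk0 : 0 < k := by positivity
  refine ⟨K * (2 * (W + c + c * N) * exp (k * N)), by positivity, fun x hx T hT => ?_⟩
  have hcont : ContinuousOn (fun p : ℝ × ℝ => exp (-(k * S.cumV p.2)) * S.wvol p.1 p.2)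
      (Icc 0 1 ×ˢ Icc 0 T) := by
    have h1 : ContinuousOn (fun p : ℝ × ℝ => S.cumV p.2) (Icc 0 1 ×ˢ Icc 0 T) :=
      timeDeriv_cumV.cont.comp continuousOn_snd fun p hp => hp.2.1
    exact (continuousOn_const.mul h1).neg.rexp.mul
      (ContinuousOn.mono S.cwvol (prod_mono_right Icc_subset_Ici_self))
  obtain ⟨⟨x₀, t₀⟩, ⟨hx₀, ht₀⟩, hmax⟩ := (isCompact_Icc.prod isCompact_Icc).exists_isMaxOn
    ⟨(x, T), hx, ⟨hT, le_rfl⟩⟩ hcont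
  set M := exp (-(k * S.cumV t₀)) * S.wvol x₀ t₀ with hM
  have hM0 : 0 < M := mul_pos (exp_pos _) (wvol_pos hx₀ ht₀.1)
  have hle : ∀ y ∈ Icc (0 : ℝ) 1, ∀ s ∈ Icc 0 T, S.wvol y s ≤ M * exp (k * S.cumV s) := by
    intro y hy s hs
    have h : exp (-(k * S.cumV s)) * S.wvol y s ≤ M := hmax (a := (y, s)) ⟨hy, hs⟩
    have h2 := mul_le_mul_of_nonneg_right h (exp_pos (k * S.cumV s)).le
    have h3 : exp (-(k * S.cumV s)) * exp (k * S.cumV s) = 1 := by rw [← exp_add]; simp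
    calc S.wvol y s = exp (-(k * S.cumV s)) * S.wvol y s * exp (k * S.cumV s) := by
          rw [mul_right_comm, h3, one_mul]
      _ ≤ _ := h2
  have hB := ((timeDeriv_cumV (S := S)).const_mul c).add
    ((timeDeriv_exp_cumV (S := S) k).const_mul (M / 2))
  have hg := (timeDeriv_wvol (S := S) hx₀).gronwall (l := 1) (b := c) ht₀.1 zero_le_one hc0.le
    (TimeDeriv.const 0) hB (wvol_pos hx₀ le_rfl).le (fun _ _ => le_rfl)
    (fun t ht => by
      have := cumV_nonneg (S := S) ht
      positivity)
    (fun t ht => by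
      have := V_nonneg (S := S) ht.1.le
      positivity)
    (fun t ht => by
      have ht0 := ht.1.le
      have hV := V_nonneg (S := S) ht0
      have h1 := hθ t ht0 (K * (M * exp (k * S.cumV t))) (by positivity) (fun y hy =>
        (u_le_wvol hy ht0).trans
          (mul_le_mul_of_nonneg_left (hle y hy t ⟨ht0, ht.2.le.trans ht₀.2⟩) hK0.le)) x₀ hx₀
      have h2 := mul_le_mul (exp_neg_potential_le (S := S) hx₀ ht0) h1
        (S.hθ_pos x₀ hx₀ t ht0).le hK0.le
      have h3 : exp (-S.potential x₀ t) * S.u x₀ t = S.wvol x₀ t := rfl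
      rw [mul_sub, h3]
      refine (sub_le_sub_right h2 _).trans (le_of_eq ?_)
      rw [hk, hc]
      ring)
  have hNt := hVN t₀ ht₀.1
  have hNt0 := cumV_nonneg (S := S) ht₀.1
  have hM1 : S.wvol x₀ t₀ = M * exp (k * S.cumV t₀) := by
    have h3 : exp (-(k * S.cumV t₀)) * exp (k * S.cumV t₀) = 1 := by rw [← exp_add]; simp
    rw [hM, mul_right_comm, h3, one_mul]
  have he : 1 ≤ exp (k * S.cumV t₀) := one_le_exp (by positivity)
  rw [exp_zero, one_mul] at hg
  have hcN := mul_le_mul_of_nonneg_left hNt hc0.le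
  have hM2 : M ≤ 2 * (W + c + c * N) := by
    have h1 := hw0 x₀ hx₀
    have h2 := mul_le_mul_of_nonneg_left he hM0.le
    simp only at hg
    linarith
  have h1 := hle x hx T ⟨hT, le_rfl⟩
  have h2 : exp (k * S.cumV T) ≤ exp (k * N) :=
    exp_le_exp.2 (mul_le_mul_of_nonneg_left (hVN T hT) hk0.le)
  refine (u_le_wvol hx hT).trans (mul_le_mul_of_nonneg_left (h1.trans ?_) hK0.le)
  exact mul_le_mul hM2 h2 (exp_pos _).le (hM0.le.trans hM2)

lemma exists_θ_le_V : ∃ C > 0, ∀ x ∈ Icc (0 : ℝ) 1, ∀ t, 0 ≤ t →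
    S.θ x t ≤ C * (1 + S.V t) := by
  obtain ⟨C₁, hC₁, hθ⟩ := exists_θ_le_of_u_le (S := S)
  obtain ⟨B, hB, hu⟩ := exists_u_le (S := S)
  refine ⟨C₁ * (1 + B), by positivity, fun x hx t ht => ?_⟩
  have h := hθ t ht B hB.le (fun y hy => hu y hy t ht) x hx
  have hV := V_nonneg (S := S) ht
  nlinarith [mul_pos hC₁ hB]

/-- At times of small entropy production the temperature is bounded from below. -/
lemma exists_θ_ge_of_V_lt : ∃ c > 0, ∃ δ > 0, ∀ t, 0 ≤ t → S.V t < δ →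
    ∀ x ∈ Icc (0 : ℝ) 1, c ≤ S.θ x t := by
  obtain ⟨Cu, hCu, hu⟩ := exists_integral_u_le (S := S)
  obtain ⟨c, hc, hθ⟩ := exists_θ_ge (S := S)
  have hβ := S.hβ
  set m := c ^ (S.β / 2) with hm
  have hm0 : 0 < m := rpow_pos_of_pos hc _
  refine ⟨(m / 2) ^ (2 / S.β), by positivity, (m / 2) ^ 2 / ((S.β / 2) ^ 2 * Cu), by positivity,
    fun t ht hVt x hx => ?_⟩
  obtain ⟨y, hy, hcy⟩ := hθ t ht
  have hV := V_nonneg (S := S) ht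
  have hθx := S.hθ_pos x hx t ht
  have h := sq_rpow_sub_le (S := S) (S.β / 2) hx hy ht
  have e : 2 * (S.β / 2) - S.β = 0 := by ring
  simp only [e, rpow_zero, mul_one] at h
  have h2 := mul_le_mul_of_nonneg_left (mul_le_mul_of_nonneg_left (hu t ht) hV)
    (sq_nonneg (S.β / 2))
  rw [lt_div_iff₀ (by positivity)] at hVt
  have h3 : (S.θ x t ^ (S.β / 2) - S.θ y t ^ (S.β / 2)) ^ 2 ≤ (m / 2) ^ 2 := by linarith
  have h4 := (abs_le.1 (abs_le_of_sq_le_sq h3 (by positivity))).1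
  have h5 : m ≤ S.θ y t ^ (S.β / 2) := rpow_le_rpow hc.le hcy (by positivity)
  have h6 : m / 2 ≤ S.θ x t ^ (S.β / 2) := by linarith
  have h7 := rpow_le_rpow (by positivity) h6 (show 0 ≤ 2 / S.β by positivity)
  rw [← rpow_mul hθx.le] at h7
  have e2 : S.β / 2 * (2 / S.β) = 1 := by field_simp
  rwa [e2, rpow_one] at h7

lemma exists_u_ge : ∃ c > 0, ∀ x ∈ Icc (0 : ℝ) 1, ∀ t, 0 ≤ t → c ≤ S.u x t := by
  obtain ⟨c, hc, δ, hδ, hθ⟩ := exists_θ_ge_of_V_lt (S := S)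
  obtain ⟨N, hN, hVN⟩ := exists_cumV_le (S := S)
  obtain ⟨W, hW, hw0⟩ := ((ContRect.const 1).div S.cwvol
    fun x hx t ht => wvol_pos hx ht).exists_initial_bound
  set K := exp (1 / 2 + S.E₀) with hK
  have hK0 : 0 < K := exp_pos _
  set d := c / K with hd
  have hd0 : 0 < d := by positivity
  have hP : 0 < exp (2 / δ * N) * (W + 1 / d) := by positivity
  refine ⟨1 / (K * (exp (2 / δ * N) * (W + 1 / d))), by positivity, fun x hx T hT => ?_⟩
  have hy : TimeDeriv (fun t => 1 / S.wvol x t) fun t =>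
      1 / S.wvol x t - exp (-S.potential x t) * S.θ x t * (1 / S.wvol x t) ^ 2 := by
    refine ⟨continuousOn_const.div (S.cwvol.timeSlice hx) fun t ht => (wvol_pos hx ht).ne',
      fun t ht => ?_⟩
    have hw := (wvol_pos (S := S) hx ht.le).ne'
    refine ((hasDerivAt_const t (1 : ℝ)).div ((timeDeriv_wvol hx).deriv t ht) hw).congr_deriv ?_
    have h3 : exp (-S.potential x t) * S.u x t = S.wvol x t := rfl
    rw [mul_sub, h3]
    field_simp
    ring
  have hg := hy.gronwall (l := 1) (b := 1 / d) hT zero_le_one (by positivity)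
    ((timeDeriv_cumV (S := S)).const_mul (2 / δ)) (TimeDeriv.const 0)
    (one_div_pos.2 (wvol_pos hx le_rfl)).le
    (fun t ht => by
      have := cumV_nonneg (S := S) ht
      positivity)
    (fun _ _ => le_rfl) (fun _ _ => le_rfl) (fun t ht => by
      have ht0 := ht.1.le
      have hV := V_nonneg (S := S) ht0
      have hyp : 0 < 1 / S.wvol x t := one_div_pos.2 (wvol_pos hx ht0)
      set y := 1 / S.wvol x t
      have hE := exp_pos (-S.potential x t)
      have hθp := S.hθ_pos x hx t ht0
      rcases lt_or_ge (S.V t) δ with h | h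
      · have h1 := hθ t ht0 h x hx
        have h2 : d ≤ exp (-S.potential x t) * S.θ x t := by
          rw [hd, div_le_iff₀ hK0]
          have := mul_le_mul (one_le_mul_exp_neg_potential (S := S) hx ht0) h1 hc.le
            (by positivity)
          linarith
        have h3 := mul_le_mul_of_nonneg_right h2 (sq_nonneg y)
        have h4 : 0 ≤ 2 / δ * S.V t * y := by positivity
        have h5 : 2 * y - d * y ^ 2 ≤ 1 / d := by
          rw [le_div_iff₀ hd0]
          nlinarith [sq_nonneg (d * y - 1)]
        linarith
      · have h1 : 2 ≤ 2 / δ * S.V t := by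
          rw [div_mul_eq_mul_div, le_div_iff₀ hδ]
          linarith
        have h2 := mul_le_mul_of_nonneg_right h1 hyp.le
        have h3 : 0 ≤ exp (-S.potential x t) * S.θ x t * y ^ 2 := by positivity
        have h4 : 0 ≤ 1 / d := by positivity
        linarith)
  have h1 : 1 / S.wvol x T ≤ exp (2 / δ * N) * (W + 1 / d) := by
    refine hg.trans ?_
    have h2 : exp (2 / δ * S.cumV T) ≤ exp (2 / δ * N) :=
      exp_le_exp.2 (mul_le_mul_of_nonneg_left (hVN T hT) (by positivity))
    have h3 := hw0 x hx
    have h4 : 0 < 1 / S.wvol x 0 := one_div_pos.2 (wvol_pos hx le_rfl)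
    refine mul_le_mul h2 (by linarith) (by positivity) (exp_pos _).le
  have hw := wvol_pos (S := S) hx hT
  rw [div_le_iff₀ hw] at h1
  rw [div_le_iff₀ (by positivity)]
  have h2 := mul_le_mul_of_nonneg_left (wvol_le_u (S := S) hx hT) hP.le
  linarith

end NSSol

lemma ContRect.freeze {F : ℝ → ℝ → ℝ} (hF : ContRect F) {t : ℝ} (ht : 0 ≤ t) :
    ContRect fun x _ => F x t :=
  ContinuousOn.comp (g := fun x => F x t) (hF.slice ht) (f := fun p : ℝ × ℝ => p.1)
    (by fun_prop) fun _ hp => hp.1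

namespace NSSol

variable (S : NSSol)

/-- The squared `L²` norm of the acceleration. -/
noncomputable def accel (t : ℝ) : ℝ := ∫ x in (0 : ℝ)..1, S.vt x t ^ 2

/-- The squared `L²` norm of `θ^β θ_x`. -/
noncomputable def heat (t : ℝ) : ℝ := ∫ x in (0 : ℝ)..1, (S.θ x t ^ S.β * S.θx x t) ^ 2

/-- The squared `L²` norm of the stress. -/
noncomputable def stressNorm (t : ℝ) : ℝ := ∫ x in (0 : ℝ)..1, S.stress x t ^ 2

/-- The functional `∫₀¹ θ^(β+2) dx`. -/
noncomputable def thermal (t : ℝ) : ℝ := ∫ x in (0 : ℝ)..1, S.θ x t ^ (S.β + 2)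

/-- The functional `∫₀¹ (v_x - θ)²/u dx`. -/
noncomputable def stressEnergy (t : ℝ) : ℝ := ∫ x in (0 : ℝ)..1, S.u x t * S.stress x t ^ 2

/-- The mean temperature. -/
noncomputable def meanθ (t : ℝ) : ℝ := ∫ x in (0 : ℝ)..1, S.θ x t

variable {S}

/-! ### The stress energy -/

lemma timeDeriv_stressEnergy : TimeDeriv S.stressEnergy fun t =>
    ∫ x in (0 : ℝ)..1, (-2 * S.vt x t ^ 2 + 2 * (S.vt x t * S.flux x t)
      + 6 * (S.stress x t * S.vt x t * S.v x t) + S.u x t * S.stress x t ^ 2) := by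
  refine ⟨(S.cu.mul (S.cstress.pow 2)).continuousOn_integral, fun t ht => ?_⟩
  have hJ := Ioi_mem_nhds ht
  have res : ∀ {F : ℝ → ℝ → ℝ}, ContRect F →
      ContinuousOn (fun p : ℝ × ℝ => F p.1 p.2) (Icc 0 1 ×ˢ Ioi 0) := fun hF =>
    ContinuousOn.mono hF (prod_mono_right Ioi_subset_Ici_self)
  have ca := S.cvt.add (S.cvt.freeze ht.le)
  have cb := S.cstress.add (S.cstress.freeze ht.le)
  have cc := S.cstress.mul (S.cstress.freeze ht.le)
  have d1 := hasDerivAt_integral_mul_sub zero_le_one hJ (res ca) (res S.cv) (res S.cvt)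
    fun x hx s hs => hasDerivAt_v (Ioo_subset_Icc_self hx) hs
  have d2 := hasDerivAt_integral_mul_sub zero_le_one hJ (res cb) (res S.ct) (res S.ctt)
    fun x hx s hs => hasDerivAt_θ (Ioo_subset_Icc_self hx) hs
  have d3 := hasDerivAt_integral_mul_sub zero_le_one hJ (res cc) (res S.cu) (res S.cut)
    fun x hx s hs => hasDerivAt_u (Ioo_subset_Icc_self hx) hs
  have d := (((d1.add d2).add d3).const_sub (S.stressEnergy t))
  refine (d.congr_of_eventuallyEq ?_).congr_deriv ?_
  · filter_upwards [hJ] with s hs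
    have hs0 : (0 : ℝ) ≤ s := le_of_lt hs
    have i1 := (ca.mul (S.cv.sub (S.cv.freeze ht.le))).slice hs0
    have i2 := (cb.mul (S.ct.sub (S.ct.freeze ht.le))).slice hs0
    have i3 := (cc.mul (S.cu.sub (S.cu.freeze ht.le))).slice hs0
    have i12 := ((ca.mul (S.cv.sub (S.cv.freeze ht.le))).add
      (cb.mul (S.ct.sub (S.ct.freeze ht.le)))).slice hs0
    have ce : ContRect fun x t => S.u x t * S.stress x t ^ 2 := S.cu.mul (S.cstress.pow 2)
    have key := integral_unit_eq_of_deriv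
      (g := fun x => (S.stress x s + S.stress x t) * (S.v x s - S.v x t))
      (f₁ := fun x => S.u x s * S.stress x s ^ 2 - S.u x t * S.stress x t ^ 2)
      (f₂ := fun x => -((S.vt x s + S.vt x t) * (S.v x s - S.v x t)
        + (S.stress x s + S.stress x t) * (S.θ x s - S.θ x t)
        + S.stress x s * S.stress x t * (S.u x s - S.u x t)))
      (fun x hx => by
        refine (((hasDerivWithinAt_stress hx hs0).add (hasDerivWithinAt_stress hx ht.le)).mul
          ((S.hvx x hx s hs0).sub (S.hvx x hx t ht.le))).congr_deriv ?_
        rw [vx_eq hx hs0, vx_eq hx ht.le]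
        simp only [Pi.add_apply, Pi.sub_apply]
        ring)
      ((ce.slice hs0).sub (ce.slice ht.le)) (i12.add i3).neg
      (by simp [stress_zero ht.le, stress_zero hs0]) (by simp [stress_one ht.le, stress_one hs0])
    rw [intervalIntegral.integral_neg, intervalIntegral.integral_add
      i12.intervalIntegrable_unit i3.intervalIntegrable_unit,
      intervalIntegral.integral_add i1.intervalIntegrable_unit i2.intervalIntegrable_unit,
      intervalIntegral.integral_sub (ce.slice hs0).intervalIntegrable_unit
      (ce.slice ht.le).intervalIntegrable_unit] at key
    simp only [stressEnergy, Pi.add_apply]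
    linarith
  · have i1 := (ca.mul S.cvt).slice ht.le
    have i2 := (cb.mul S.ctt).slice ht.le
    have i3 := (cc.mul S.cut).slice ht.le
    have i12 := ((ca.mul S.cvt).add (cb.mul S.ctt)).slice ht.le
    rw [← intervalIntegral.integral_add i1.intervalIntegrable_unit i2.intervalIntegrable_unit,
      ← intervalIntegral.integral_add i12.intervalIntegrable_unit
        i3.intervalIntegrable_unit, ← intervalIntegral.integral_neg]
    refine integral_unit_eq_of_deriv
      (g := fun x => -2 * (S.stress x t * S.flux x t) - 3 * (S.stress x t ^ 2 * S.v x t))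
      (fun x hx => ?_) (i12.add i3).neg
      ((((((ContRect.const (-2)).mul (S.cvt.pow 2)).add
        ((ContRect.const 2).mul (S.cvt.mul S.cflux))).add
        ((ContRect.const 6).mul ((S.cstress.mul S.cvt).mul S.cv))).add
        (S.cu.mul (S.cstress.pow 2))).slice ht.le)
      (by simp [stress_zero ht.le]) (by simp [stress_one ht.le])
    have hσ := hasDerivWithinAt_stress (S := S) hx ht.le
    refine (((hσ.mul (hasDerivWithinAt_flux hx ht.le)).const_mul (-2)).sub
      (((hσ.pow 2).mul (S.hvx x hx t ht.le)).const_mul 3)).congr_deriv ?_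
    have hm := S.mass x hx t ht.le
    simp only [Pi.pow_apply]
    push_cast
    linear_combination (S.stress x t ^ 2) * hm

lemma stress_sq_le_interp {η : ℝ} (hη : 0 < η) {x t : ℝ} (hx : x ∈ Icc (0 : ℝ) 1) (ht : 0 ≤ t) :
    S.stress x t ^ 2 ≤ η * S.accel t + 1 / η * S.stressNorm t := by
  have cd : ContRect fun x t => 2 * (S.stress x t * S.vt x t) :=
    (ContRect.const 2).mul (S.cstress.mul S.cvt)
  have h := abs_sub_le_integral_abs_deriv (g := fun y => S.stress y t ^ 2)
    (g' := fun y => 2 * (S.stress y t * S.vt y t))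
    (fun y hy => ((hasDerivWithinAt_stress hy ht).pow 2).congr_deriv (by push_cast; ring))
    (cd.slice ht) hx (y := 0) ⟨le_rfl, zero_le_one⟩
  have h2 := integral_unit_le_comb η (1 / η) 0 (cd.abs.slice ht) ((S.cvt.pow 2).slice ht)
    ((S.cstress.pow 2).slice ht) (continuousOn_const (c := (0 : ℝ))) fun y _ => by
      have e : η * S.vt y t ^ 2 + 1 / η * S.stress y t ^ 2 - 2 * |S.stress y t| * |S.vt y t|
          = 1 / η * (η * |S.vt y t| - |S.stress y t|) ^ 2 := by
        rw [← sq_abs (S.vt y t), ← sq_abs (S.stress y t)]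
        field_simp
        ring
      have : 0 ≤ 1 / η * (η * |S.vt y t| - |S.stress y t|) ^ 2 := by positivity
      rw [abs_mul, abs_mul, abs_two]
      linarith
  rw [stress_zero ht] at h
  simp only [ne_eq, OfNat.ofNat_ne_zero, not_false_eq_true, zero_pow, sub_zero] at h
  rw [abs_of_nonneg (sq_nonneg _)] at h
  unfold accel stressNorm
  linarith

lemma accel_nonneg (t : ℝ) : 0 ≤ S.accel t := integral_unit_nonneg fun _ _ => sq_nonneg _

lemma heat_nonneg (t : ℝ) : 0 ≤ S.heat t := integral_unit_nonneg fun _ _ => sq_nonneg _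

lemma stressNorm_nonneg (t : ℝ) : 0 ≤ S.stressNorm t :=
  integral_unit_nonneg fun _ _ => sq_nonneg _

lemma thermal_nonneg {t : ℝ} (ht : 0 ≤ t) : 0 ≤ S.thermal t :=
  integral_unit_nonneg fun x hx => (rpow_pos_of_pos (S.hθ_pos x hx t ht) _).le

lemma integral_stress_sq_mul_v_sq_le {η : ℝ} (hη : 0 < η) {t : ℝ} (ht : 0 ≤ t) :
    ∫ x in (0 : ℝ)..1, S.stress x t ^ 2 * S.v x t ^ 2
      ≤ 2 * S.E₀ * (η * S.accel t + 1 / η * S.stressNorm t) := by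
  have hnn : 0 ≤ η * S.accel t + 1 / η * S.stressNorm t := by
    have := accel_nonneg (S := S) t
    have := stressNorm_nonneg (S := S) t
    positivity
  have h := integral_unit_le_comb (η * S.accel t + 1 / η * S.stressNorm t) 0 0
    (((S.cstress.pow 2).mul (S.cv.pow 2)).slice ht) ((S.cv.pow 2).slice ht)
    (continuousOn_const (c := (0 : ℝ))) (continuousOn_const (c := (0 : ℝ))) fun x hx => by
      have := mul_le_mul_of_nonneg_right (stress_sq_le_interp (S := S) hη hx ht)
        (sq_nonneg (S.v x t))
      linarith
  have h2 := mul_le_mul_of_nonneg_left (integral_v_sq_le (S := S) ht) hnn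
  linarith

lemma exists_stressEnergy_deriv_le : ∃ C > 0, ∀ t, 0 ≤ t →
    ∫ x in (0 : ℝ)..1, (-2 * S.vt x t ^ 2 + 2 * (S.vt x t * S.flux x t)
      + 6 * (S.stress x t * S.vt x t * S.v x t) + S.u x t * S.stress x t ^ 2)
      ≤ -(3 / 4) * S.accel t + C * (S.heat t + S.stressNorm t) := by
  obtain ⟨U, hU, hU'⟩ := exists_u_le (S := S)
  obtain ⟨c, hc, hc'⟩ := exists_u_ge (S := S)
  have hE := E₀_pos (S := S)
  set η := 1 / (144 * S.E₀) with hη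
  have hη0 : 0 < η := by positivity
  refine ⟨2 / c ^ 2 + (36 * S.E₀ / η + U), by positivity, fun t ht => ?_⟩
  have cf : ContRect fun x t => (-2 * S.vt x t ^ 2 + 2 * (S.vt x t * S.flux x t)
      + 6 * (S.stress x t * S.vt x t * S.v x t) + S.u x t * S.stress x t ^ 2) :=
    ((((ContRect.const (-2)).mul (S.cvt.pow 2)).add
        ((ContRect.const 2).mul (S.cvt.mul S.cflux))).add
        ((ContRect.const 6).mul ((S.cstress.mul S.cvt).mul S.cv))).add
        (S.cu.mul (S.cstress.pow 2))
  have cg : ContRect fun x t => -1 * S.vt x t ^ 2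
      + 2 / c ^ 2 * (S.θ x t ^ S.β * S.θx x t) ^ 2 :=
    ((ContRect.const (-1)).mul (S.cvt.pow 2)).add
      ((ContRect.const _).mul (((S.crpow _).mul S.ctx).pow 2))
  have h1 := integral_unit_le_comb 1 18 U (cf.slice ht) (cg.slice ht)
    (((S.cstress.pow 2).mul (S.cv.pow 2)).slice ht) ((S.cstress.pow 2).slice ht)
    fun x hx => by
      have hu := S.hu_pos x hx t ht
      have q2 : S.flux x t ^ 2 ≤ 1 / c ^ 2 * (S.θ x t ^ S.β * S.θx x t) ^ 2 := by
        unfold flux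
        rw [div_pow, div_eq_mul_one_div, mul_comm]
        have := hc' x hx t ht
        gcongr
      have e1 : 2 / c ^ 2 * (S.θ x t ^ S.β * S.θx x t) ^ 2
        = 2 * (1 / c ^ 2 * (S.θ x t ^ S.β * S.θx x t) ^ 2) := by ring
      have h3 := mul_le_mul_of_nonneg_right (hU' x hx t ht) (sq_nonneg (S.stress x t))
      nlinarith [sq_nonneg (S.vt x t - 2 * S.flux x t),
        sq_nonneg (S.vt x t - 6 * (S.stress x t * S.v x t))]
  have h2 := integral_unit_le_comb (-1) (2 / c ^ 2) 0 (cg.slice ht) ((S.cvt.pow 2).slice ht)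
    ((((S.crpow S.β).mul S.ctx).pow 2).slice ht) (continuousOn_const (c := (0 : ℝ)))
    fun x hx => by simp
  have h3 := integral_stress_sq_mul_v_sq_le (S := S) hη0 ht
  have e : 18 * (2 * S.E₀ * (η * S.accel t + 1 / η * S.stressNorm t))
      = 1 / 4 * S.accel t + 36 * S.E₀ / η * S.stressNorm t := by
    rw [hη]; field_simp; ring
  have hH := heat_nonneg (S := S) t
  have hN := stressNorm_nonneg (S := S) t
  have p1 : 0 ≤ (36 * S.E₀ / η + U) * S.heat t := by positivity
  have p2 : 0 ≤ 2 / c ^ 2 * S.stressNorm t := by positivity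
  simp only [accel, heat, stressNorm] at *
  linarith

/-! ### The thermal energy -/

lemma timeDeriv_meanθ : TimeDeriv S.meanθ fun t => ∫ x in (0 : ℝ)..1, S.θt x t :=
  S.ct.timeDeriv_integral S.ctt fun _ hx _ ht => hasDerivAt_θ (Ioo_subset_Icc_self hx) ht

lemma meanθ_pos {t : ℝ} (ht : 0 ≤ t) : 0 < S.meanθ t := by
  obtain ⟨x, hx, h⟩ := exists_le_integral_unit (S.ct.slice ht)
  exact (S.hθ_pos x hx t ht).trans_le h

lemma timeDeriv_thermal_sub :
    TimeDeriv (fun t => S.thermal t - S.meanθ t ^ (S.β + 2)) fun t => (S.β + 2) *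
      ∫ x in (0 : ℝ)..1, (-(S.β + 1) * ((S.θ x t ^ S.β * S.θx x t) ^ 2 / S.u x t)
        - (S.β + 1) * (S.θ x t ^ S.β * S.θx x t * (S.stress x t * S.v x t))
        - (S.θ x t ^ (S.β + 1) - S.meanθ t ^ (S.β + 1)) * (S.vt x t * S.v x t)) := by
  have hβ := S.hβ
  have hp : S.β + 2 - 1 = S.β + 1 := by ring
  have h1 := ContRect.timeDeriv_integral (S.crpow (S.β + 2))
    (F' := fun x t => (S.β + 2) * (S.θ x t ^ (S.β + 1) * S.θt x t))
    ((ContRect.const _).mul ((S.crpow _).mul S.ctt)) fun x hx t ht => by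
      have hx' := Ioo_subset_Icc_self hx
      refine ((hasDerivAt_θ hx' ht).rpow_const
        (Or.inl (S.hθ_pos x hx' t ht.le).ne')).congr_deriv ?_
      rw [hp]; ring
  have hm := timeDeriv_meanθ (S := S)
  have h2 : TimeDeriv (fun t => S.meanθ t ^ (S.β + 2)) fun t =>
      (∫ x in (0 : ℝ)..1, S.θt x t) * (S.β + 2) * S.meanθ t ^ (S.β + 2 - 1) :=
    ⟨hm.cont.rpow_const fun t _ => Or.inr (by linarith),
      fun t ht => (hm.deriv t ht).rpow_const (Or.inr (by linarith))⟩
  refine (h1.sub h2).congr_deriv fun t ht => ?_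
  have c1 := ((S.crpow (S.β + 1)).mul S.ctt).slice ht.le
  have cm := (S.crpow (S.β + 1)).sub (ContRect.const (S.meanθ t ^ (S.β + 1)))
  have cp := (S.crpow S.β).mul S.ctx
  have key := integral_unit_eq_of_deriv
    (g := fun x => (S.θ x t ^ (S.β + 1) - S.meanθ t ^ (S.β + 1))
      * (S.flux x t + S.stress x t * S.v x t))
    (f₁ := fun x => (S.θ x t ^ (S.β + 1) - S.meanθ t ^ (S.β + 1)) * S.θt x t)
    (f₂ := fun x => -(S.β + 1) * ((S.θ x t ^ S.β * S.θx x t) ^ 2 / S.u x t)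
        - (S.β + 1) * (S.θ x t ^ S.β * S.θx x t * (S.stress x t * S.v x t))
        - (S.θ x t ^ (S.β + 1) - S.meanθ t ^ (S.β + 1)) * (S.vt x t * S.v x t))
    (fun x hx => by
      refine (((hasDerivWithinAt_rpow (S.β + 1) hx ht.le).sub_const _).mul
        ((hasDerivWithinAt_flux hx ht.le).add
          ((hasDerivWithinAt_stress hx ht.le).mul (S.hvx x hx t ht.le)))).congr_deriv ?_
      rw [add_sub_cancel_right]
      have hu := (S.hu_pos x hx t ht.le).ne'
      simp only [Pi.add_apply, Pi.mul_apply]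
      unfold flux
      field_simp
      ring)
    ((cm.mul S.ctt).slice ht.le)
    ((((((ContRect.const _).mul ((cp.pow 2).div S.cu S.hu_pos)).sub
      ((ContRect.const _).mul (cp.mul (S.cstress.mul S.cv)))).sub
      (cm.mul (S.cvt.mul S.cv)))).slice ht.le)
    (by simp [stress_zero ht.le, flux_zero ht.le]) (by simp [stress_one ht.le, flux_one ht.le])
  rw [← key]
  simp only [sub_mul]
  rw [intervalIntegral.integral_sub c1.intervalIntegrable_unit
    (((ContRect.const (S.meanθ t ^ (S.β + 1))).mul S.ctt).slice ht.le).intervalIntegrable_unit,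
    intervalIntegral.integral_const_mul, intervalIntegral.integral_const_mul, hp]
  ring

lemma sq_rpow_sub_meanθ_le {U : ℝ} (hU : ∀ x ∈ Icc (0 : ℝ) 1, ∀ t, 0 ≤ t → S.u x t ≤ U)
    {x t : ℝ} (hx : x ∈ Icc (0 : ℝ) 1) (ht : 0 ≤ t) :
    (S.θ x t ^ (S.β + 1) - S.meanθ t ^ (S.β + 1)) ^ 2
      ≤ (S.β + 1) ^ 2 * (S.V t * (U * S.thermal t)) := by
  have hβ := S.hβ
  obtain ⟨y, hy, hy'⟩ := exists_le_integral_unit (S.ct.slice ht)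
  obtain ⟨z, hz, hz'⟩ := exists_integral_unit_le (S.ct.slice ht)
  have hyp := rpow_le_rpow (S.hθ_pos y hy t ht).le hy' (by linarith : 0 ≤ S.β + 1)
  have hzp := rpow_le_rpow (meanθ_pos ht).le hz' (by linarith : 0 ≤ S.β + 1)
  have hI : ∫ z in (0 : ℝ)..1, S.u z t * S.θ z t ^ (2 * (S.β + 1) - S.β) ≤ U * S.thermal t := by
    have e : 2 * (S.β + 1) - S.β = S.β + 2 := by ring
    rw [e]
    have := integral_unit_le_comb U 0 0 ((S.cu.mul (S.crpow (S.β + 2))).slice ht)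
      ((S.crpow (S.β + 2)).slice ht) (continuousOn_const (c := (0 : ℝ)))
      (continuousOn_const (c := (0 : ℝ))) fun x hx => by
        have := mul_le_mul_of_nonneg_right (hU x hx t ht)
          (rpow_pos_of_pos (S.hθ_pos x hx t ht) (S.β + 2)).le
        linarith
    unfold thermal
    linarith
  have hV := V_nonneg (S := S) ht
  have osc : ∀ y ∈ Icc (0 : ℝ) 1, (S.θ x t ^ (S.β + 1) - S.θ y t ^ (S.β + 1)) ^ 2
      ≤ (S.β + 1) ^ 2 * (S.V t * (U * S.thermal t)) := fun y hy =>
    (sq_rpow_sub_le (S.β + 1) hx hy ht).trans (by gcongr)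
  change S.θ y t ^ (S.β + 1) ≤ S.meanθ t ^ (S.β + 1) at hyp
  change S.meanθ t ^ (S.β + 1) ≤ S.θ z t ^ (S.β + 1) at hzp
  rcases le_total (S.meanθ t ^ (S.β + 1)) (S.θ x t ^ (S.β + 1)) with h | h
  · refine le_trans ?_ (osc y hy)
    exact pow_le_pow_left₀ (by linarith) (by linarith) 2
  · refine le_trans ?_ (osc z hz)
    rw [← neg_sq, ← neg_sq (S.θ x t ^ (S.β + 1) - S.θ z t ^ (S.β + 1))]
    exact pow_le_pow_left₀ (by linarith) (by linarith) 2

lemma exists_thermal_deriv_le : ∃ c > 0, ∀ ε > 0, ∃ C > 0, ∀ t, 0 ≤ t →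
    ∫ x in (0 : ℝ)..1, (-(S.β + 1) * ((S.θ x t ^ S.β * S.θx x t) ^ 2 / S.u x t)
        - (S.β + 1) * (S.θ x t ^ S.β * S.θx x t * (S.stress x t * S.v x t))
        - (S.θ x t ^ (S.β + 1) - S.meanθ t ^ (S.β + 1)) * (S.vt x t * S.v x t))
      ≤ -c * S.heat t + 2 * ε * S.accel t + C * (S.stressNorm t + S.V t * S.thermal t) := by
  obtain ⟨U, hU, hU'⟩ := exists_u_le (S := S)
  have hE := E₀_pos (S := S)
  have hβ := S.hβ
  have hd : 0 < S.β + 1 := by linarith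
  refine ⟨(S.β + 1) / (2 * U), by positivity, fun ε hε => ?_⟩
  set η := ε / ((S.β + 1) * U * S.E₀) with hη
  have hη0 : 0 < η := by positivity
  refine ⟨(S.β + 1) * U * S.E₀ / η + (S.β + 1) ^ 2 * U * S.E₀ / (2 * ε), by positivity,
    fun t ht => ?_⟩
  have cp := (S.crpow S.β).mul S.ctx
  have cm := (S.crpow (S.β + 1)).sub (ContRect.const (S.meanθ t ^ (S.β + 1)))
  have ca := cp.mul (S.cstress.mul S.cv)
  have cf : ContRect fun x s => -(S.β + 1) * ((S.θ x s ^ S.β * S.θx x s) ^ 2 / S.u x s)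
        - (S.β + 1) * (S.θ x s ^ S.β * S.θx x s * (S.stress x s * S.v x s))
        - (S.θ x s ^ (S.β + 1) - S.meanθ t ^ (S.β + 1)) * (S.vt x s * S.v x s) :=
    ((((ContRect.const _).mul ((cp.pow 2).div S.cu S.hu_pos)).sub
      ((ContRect.const _).mul (cp.mul (S.cstress.mul S.cv)))).sub
      (cm.mul (S.cvt.mul S.cv)))
  have cg : ContRect fun x t => -((S.β + 1) / (2 * U)) * (S.θ x t ^ S.β * S.θx x t) ^ 2
      + ε * S.vt x t ^ 2 :=
    ((ContRect.const _).mul (cp.pow 2)).add ((ContRect.const _).mul (S.cvt.pow 2))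
  have h1 := integral_unit_le_comb 1 ((S.β + 1) * U / 2)
    (1 / (4 * ε) * ((S.β + 1) ^ 2 * (S.V t * (U * S.thermal t)))) (cf.slice ht) (cg.slice ht)
    (((S.cstress.pow 2).mul (S.cv.pow 2)).slice ht) ((S.cv.pow 2).slice ht) fun x hx => by
      have hu := S.hu_pos x hx t ht
      have h2 := mul_le_mul_of_nonneg_right (sq_rpow_sub_meanθ_le hU' hx ht)
        (sq_nonneg (S.v x t))
      generalize S.θ x t ^ (S.β + 1) - S.meanθ t ^ (S.β + 1) = a at h2 ⊢
      generalize S.θ x t ^ S.β * S.θx x t = p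
      have e1 : p ^ 2 / U ≤ p ^ 2 / S.u x t := by
        have := hU' x hx t ht
        gcongr
      have e2 : -(a * (S.vt x t * S.v x t)) ≤ ε * S.vt x t ^ 2
          + 1 / (4 * ε) * (a ^ 2 * S.v x t ^ 2) := by
        have : ε * S.vt x t ^ 2 + 1 / (4 * ε) * (a ^ 2 * S.v x t ^ 2) + a * (S.vt x t * S.v x t)
            = 1 / (4 * ε) * (2 * ε * S.vt x t + a * S.v x t) ^ 2 := by field_simp; ring
        have : 0 ≤ 1 / (4 * ε) * (2 * ε * S.vt x t + a * S.v x t) ^ 2 := by positivity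
        linarith
      have e3 : -(p * (S.stress x t * S.v x t)) ≤ p ^ 2 / (2 * U)
          + U / 2 * (S.stress x t ^ 2 * S.v x t ^ 2) := by
        have : p ^ 2 / (2 * U) + U / 2 * (S.stress x t ^ 2 * S.v x t ^ 2)
            + p * (S.stress x t * S.v x t)
            = 1 / (2 * U) * (p + U * (S.stress x t * S.v x t)) ^ 2 := by field_simp; ring
        have : 0 ≤ 1 / (2 * U) * (p + U * (S.stress x t * S.v x t)) ^ 2 := by positivity
        linarith
      have e4 := mul_le_mul_of_nonneg_left e1 hd.le
      have e5 := mul_le_mul_of_nonneg_left e3 hd.le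
      have e6 := mul_le_mul_of_nonneg_left h2 (by positivity : 0 ≤ 1 / (4 * ε))
      have e7 : (S.β + 1) * (p ^ 2 / U) = (S.β + 1) / U * p ^ 2 := by ring
      have e8 : (S.β + 1) * (p ^ 2 / (2 * U)) = (S.β + 1) / U * p ^ 2 / 2 := by field_simp
      have e9 : (S.β + 1) / (2 * U) * p ^ 2 = (S.β + 1) / U * p ^ 2 / 2 := by field_simp
      linarith
  have h2 := integral_unit_le_comb (-((S.β + 1) / (2 * U))) ε 0 (cg.slice ht)
    ((cp.pow 2).slice ht) ((S.cvt.pow 2).slice ht) (continuousOn_const (c := (0 : ℝ)))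
    fun x hx => by simp
  have h3 := mul_le_mul_of_nonneg_left (integral_stress_sq_mul_v_sq_le (S := S) hη0 ht)
    (by positivity : 0 ≤ (S.β + 1) * U / 2)
  have hV := V_nonneg (S := S) ht
  have hQ := thermal_nonneg (S := S) ht
  have hN := stressNorm_nonneg (S := S) t
  have h4 := mul_le_mul_of_nonneg_left (integral_v_sq_le (S := S) ht)
    (by positivity : 0 ≤ 1 / (4 * ε) * ((S.β + 1) ^ 2 * (S.V t * (U * S.thermal t))))
  have e : (S.β + 1) * U / 2 * (2 * S.E₀ * (η * S.accel t + 1 / η * S.stressNorm t))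
      = ε * S.accel t + (S.β + 1) * U * S.E₀ / η * S.stressNorm t := by
    rw [hη]; field_simp
  have e' : 1 / (4 * ε) * ((S.β + 1) ^ 2 * (S.V t * (U * S.thermal t))) * (2 * S.E₀)
      = (S.β + 1) ^ 2 * U * S.E₀ / (2 * ε) * (S.V t * S.thermal t) := by
    field_simp; ring
  have p1 : 0 ≤ (S.β + 1) * U * S.E₀ / η * (S.V t * S.thermal t) := by positivity
  have p2 : 0 ≤ (S.β + 1) ^ 2 * U * S.E₀ / (2 * ε) * S.stressNorm t := by positivity
  have dH : ∫ x in (0 : ℝ)..1, (S.θ x t ^ S.β * S.θx x t) ^ 2 = S.heat t := rfl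
  have dD : ∫ x in (0 : ℝ)..1, S.vt x t ^ 2 = S.accel t := rfl
  rw [dH, dD] at h2
  linarith

/-! ### Closing the estimate -/

lemma exists_stressNorm_le : ∃ C > 0, ∀ t, 0 ≤ t →
    S.stressNorm t ≤ C * S.V t * (1 + S.stressEnergy t) := by
  obtain ⟨K, hK, hθ⟩ := exists_θ_le_V (S := S)
  obtain ⟨c, hc, hu⟩ := exists_u_ge (S := S)
  refine ⟨2 * K / c + 1 / c, by positivity, fun t ht => ?_⟩
  have hV := V_nonneg (S := S) ht
  have hF : 0 ≤ S.stressEnergy t := integral_unit_nonneg fun x hx =>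
    mul_nonneg (S.hu_pos x hx t ht).le (sq_nonneg _)
  have h1 := integral_unit_le_comb (1 / c * (K * (1 + S.V t))) 0 0
    ((S.cstress.pow 2).slice ht) (S.cdissip.slice ht) (continuousOn_const (c := (0 : ℝ)))
    (continuousOn_const (c := (0 : ℝ))) fun x hx => by
      have hu0 := S.hu_pos x hx t ht
      have hθ0 := S.hθ_pos x hx t ht
      have e : S.stress x t ^ 2 = 1 / S.u x t * S.θ x t
          * ((S.vx x t - S.θ x t) ^ 2 / (S.u x t * S.θ x t)) := by
        unfold stress; field_simp
      have e2 : (S.vx x t - S.θ x t) ^ 2 / (S.u x t * S.θ x t) ≤ S.dissip x t := by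
        unfold dissip
        have : 0 ≤ S.θ x t ^ S.β * (S.θx x t) ^ 2 / (S.u x t * (S.θ x t) ^ 2) := by positivity
        linarith
      have e3 := hu x hx t ht
      have e4 := hθ x hx t ht
      have e5 := dissip_nonneg (S := S) hx ht
      rw [e]
      calc _ ≤ 1 / c * (K * (1 + S.V t)) * S.dissip x t := by gcongr
        _ = _ := by ring
  have h2 := integral_unit_le_comb (1 / c) 0 0 ((S.cstress.pow 2).slice ht)
    ((S.cu.mul (S.cstress.pow 2)).slice ht) (continuousOn_const (c := (0 : ℝ)))
    (continuousOn_const (c := (0 : ℝ))) fun x hx => by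
      have := mul_le_mul_of_nonneg_right (hu x hx t ht) (sq_nonneg (S.stress x t))
      have h5 : S.stress x t ^ 2 ≤ 1 / c * (S.u x t * S.stress x t ^ 2) := by
        rw [one_div, ← div_eq_inv_mul, le_div_iff₀ hc]
        linarith
      linarith
  have h1' : S.stressNorm t ≤ K / c * (1 + S.V t) * S.V t := by
    refine h1.trans (le_of_eq ?_)
    rw [V_eq]; ring
  have h2' : S.stressNorm t ≤ 1 / c * S.stressEnergy t := by
    unfold stressNorm stressEnergy; linarith
  rcases le_total (S.V t) 1 with h | h
  · calc S.stressNorm t ≤ K / c * (1 + S.V t) * S.V t := h1'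
      _ ≤ K / c * (1 + 1) * S.V t := by gcongr
      _ = 2 * K / c * S.V t * (1 + 0) := by ring
      _ ≤ _ := by gcongr; simp [hc.le]
  · calc S.stressNorm t ≤ 1 / c * S.stressEnergy t := h2'
      _ = 1 / c * 1 * (0 + S.stressEnergy t) := by ring
      _ ≤ _ := by
        gcongr
        · have : 0 < 2 * K / c := by positivity
          linarith
        · exact zero_le_one

/-- The stress energy and the thermal energy are bounded, and the corresponding dissipation
rates are dominated by the derivative of a bounded function. -/
lemma exists_dissipation_bound : ∃ C > 0, ∃ W W' : ℝ → ℝ, TimeDeriv W W' ∧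
    (∀ t, 0 ≤ t → S.stressEnergy t ≤ C) ∧ (∀ t, 0 ≤ t → S.thermal t ≤ C) ∧
    (∀ t, 0 ≤ t → 0 ≤ W t) ∧ (∀ t, 0 ≤ t → W t ≤ C) ∧
    ∀ t, 0 < t → S.accel t + S.heat t ≤ W' t := by
  obtain ⟨C₁, hC₁, hF⟩ := exists_stressEnergy_deriv_le (S := S)
  obtain ⟨c, hc, hM⟩ := exists_thermal_deriv_le (S := S)
  obtain ⟨C₃, hC₃, hN⟩ := exists_stressNorm_le (S := S)
  obtain ⟨N, hN0, hVN⟩ := exists_cumV_le (S := S)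
  have hβ := S.hβ
  set K := (C₁ + 1) / c with hK
  have hK0 : 0 < K := by positivity
  obtain ⟨C₂, hC₂, hM⟩ := hM (1 / (8 * K)) (by positivity)
  set k := K / (S.β + 2) with hk
  have hk0 : 0 < k := by positivity
  have hY := (timeDeriv_stressEnergy (S := S)).add
    (((timeDeriv_thermal_sub (S := S)).add (TimeDeriv.const (S.E₀ ^ (S.β + 2)))).const_mul k)
  set Y : ℝ → ℝ := fun t => S.stressEnergy t
    + k * (S.thermal t - S.meanθ t ^ (S.β + 2) + S.E₀ ^ (S.β + 2)) with hYdef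
  have hFnn : ∀ t, 0 ≤ t → 0 ≤ S.stressEnergy t := fun t ht =>
    integral_unit_nonneg fun x hx => mul_nonneg (S.hu_pos x hx t ht).le (sq_nonneg _)
  have hYge : ∀ t, 0 ≤ t → S.stressEnergy t + k * S.thermal t ≤ Y t := by
    intro t ht
    have := rpow_le_rpow (meanθ_pos ht).le (integral_θ_le (S := S) ht)
      (by linarith : 0 ≤ S.β + 2)
    have := mul_le_mul_of_nonneg_left this hk0.le
    simp only [hYdef]
    linarith
  have hYnn : ∀ t, 0 ≤ t → 0 ≤ Y t := fun t ht => by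
    have := hYge t ht
    have := hFnn t ht
    have := mul_nonneg hk0.le (thermal_nonneg (S := S) ht)
    linarith
  set C₄ := (C₁ + K * C₂) * (C₃ + 1 / k) with hC₄
  have hC₄0 : 0 < C₄ := by positivity
  have hrate : ∀ t, 0 ≤ t → S.stressNorm t + S.V t * S.thermal t
      ≤ (C₃ + 1 / k) * (S.V t * (1 + Y t)) := by
    intro t ht
    have hV := V_nonneg (S := S) ht
    have hQ := thermal_nonneg (S := S) ht
    have h0 := hYge t ht
    have h1 : S.thermal t ≤ 1 / k * (1 + Y t) := by
      rw [one_div, ← div_eq_inv_mul, le_div_iff₀ hk0]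
      linarith [hFnn t ht]
    have h2 := mul_le_mul_of_nonneg_left h1 hV
    have h3 : S.stressEnergy t ≤ Y t := by linarith [mul_nonneg hk0.le hQ]
    have h4 := hN t ht
    have h5 : C₃ * S.V t * (1 + S.stressEnergy t) ≤ C₃ * S.V t * (1 + Y t) := by gcongr
    linarith
  have hY' : ∀ t, 0 ≤ t → (∫ x in (0 : ℝ)..1, (-2 * S.vt x t ^ 2 + 2 * (S.vt x t * S.flux x t)
      + 6 * (S.stress x t * S.vt x t * S.v x t) + S.u x t * S.stress x t ^ 2))
      + k * ((S.β + 2) * (∫ x in (0 : ℝ)..1,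
        (-(S.β + 1) * ((S.θ x t ^ S.β * S.θx x t) ^ 2 / S.u x t)
        - (S.β + 1) * (S.θ x t ^ S.β * S.θx x t * (S.stress x t * S.v x t))
        - (S.θ x t ^ (S.β + 1) - S.meanθ t ^ (S.β + 1)) * (S.vt x t * S.v x t))) + 0)
      ≤ -(1 / 2) * S.accel t - S.heat t + C₄ * (S.V t * (1 + Y t)) := by
    intro t ht
    have h1 := hF t ht
    have h2 := mul_le_mul_of_nonneg_left (hM t ht) hK0.le
    have h3 := mul_le_mul_of_nonneg_left (hrate t ht) (by positivity : 0 ≤ C₁ + K * C₂)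
    have hV := mul_nonneg (V_nonneg (S := S) ht) (thermal_nonneg (S := S) ht)
    have hV' := mul_nonneg hC₁.le hV
    have e1 : k * (S.β + 2) = K := by rw [hk]; field_simp
    have e2 : K * c = C₁ + 1 := by rw [hK]; field_simp
    have e3 : K * (2 * (1 / (8 * K)) * S.accel t) = 1 / 4 * S.accel t := by field_simp; ring
    have e4 : K * (-c * S.heat t) = -((C₁ + 1) * S.heat t) := by rw [← e2]; ring
    rw [add_zero, ← mul_assoc k, e1, hC₄]
    generalize (∫ x in (0 : ℝ)..1, (-(S.β + 1) * ((S.θ x t ^ S.β * S.θx x t) ^ 2 / S.u x t)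
        - (S.β + 1) * (S.θ x t ^ S.β * S.θx x t * (S.stress x t * S.v x t))
        - (S.θ x t ^ (S.β + 1) - S.meanθ t ^ (S.β + 1)) * (S.vt x t * S.v x t))) = I at h2 ⊢
    linarith
  have hV := timeDeriv_cumV (S := S)
  have hnn4 : ∀ t, 0 ≤ t → 0 ≤ C₄ * S.cumV t := fun t ht => mul_nonneg hC₄0.le (cumV_nonneg ht)
  have hYle : ∀ t, 0 ≤ t → Y t ≤ exp (C₄ * N) * (Y 0 + 0 + C₄ * N) := by
    intro t ht
    have := hY.gronwall ht le_rfl le_rfl (hV.const_mul C₄) (hV.const_mul C₄)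
      (hYnn 0 le_rfl) hnn4 hnn4 (fun s hs => mul_nonneg hC₄0.le (V_nonneg hs.1.le))
      fun s hs => by
        have := hY' s hs.1.le
        have := accel_nonneg (S := S) s
        have := heat_nonneg (S := S) s
        simp only [zero_mul, zero_add]
        linarith
    refine this.trans ?_
    have h1 := hVN t ht
    have h2 := hYnn 0 le_rfl
    have h3 := cumV_nonneg (S := S) ht
    gcongr
  set M := exp (C₄ * N) * (Y 0 + 0 + C₄ * N) with hM'
  have hM0 : 0 ≤ M := (hYnn 0 le_rfl).trans (hYle 0 le_rfl)
  have hW := ((hV.const_mul (2 * (C₄ * (1 + M)))).sub (hY.const_mul 2)).add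
    (TimeDeriv.const (2 * M))
  refine ⟨M + 1 / k * M + (2 * (C₄ * (1 + M)) * N + 2 * M) + 1, by positivity, _, _, hW,
    fun t ht => ?_, fun t ht => ?_, fun t ht => ?_, fun t ht => ?_, fun t ht => ?_⟩
  · have h1 := hYle t ht
    have h2 := hYge t ht
    have h3 := mul_nonneg hk0.le (thermal_nonneg (S := S) ht)
    have : 0 ≤ 1 / k * M + (2 * (C₄ * (1 + M)) * N + 2 * M) := by positivity
    linarith
  · have h1 := hYle t ht
    have h2 := hYge t ht
    have h3 := hFnn t ht
    have h4 : S.thermal t ≤ 1 / k * M := by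
      rw [one_div, ← div_eq_inv_mul, le_div_iff₀ hk0]
      linarith
    have : 0 ≤ 2 * (C₄ * (1 + M)) * N + 2 * M := by positivity
    linarith
  · have h1 := hYle t ht
    have := mul_nonneg (by positivity : 0 ≤ 2 * (C₄ * (1 + M))) (cumV_nonneg (S := S) ht)
    linarith
  · have h1 := hYnn t ht
    have := mul_le_mul_of_nonneg_left (hVN t ht) (by positivity : 0 ≤ 2 * (C₄ * (1 + M)))
    have : 0 ≤ 1 / k * M := by positivity
    linarith
  · have h1 := hY' t ht.le
    have h2 := heat_nonneg (S := S) t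
    have h3 : C₄ * (S.V t * (1 + Y t)) ≤ C₄ * (S.V t * (1 + M)) := by
      have := V_nonneg (S := S) ht.le
      have := hYle t ht.le
      gcongr
    linarith

/-! ### The negative moment of the temperature -/

/-- The negative moment `∫₀¹ θ^(-β)`. -/
noncomputable def coldness (S : NSSol) (t : ℝ) : ℝ := ∫ x in (0 : ℝ)..1, S.θ x t ^ (-S.β)

/-- The squared norm `∫₀¹ (θ_x/θ)²` of the gradient of `log θ`. -/
noncomputable def logGrad (S : NSSol) (t : ℝ) : ℝ :=
  ∫ x in (0 : ℝ)..1, S.θx x t ^ 2 / S.θ x t ^ 2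

lemma coldness_nonneg {t : ℝ} (ht : 0 ≤ t) : 0 ≤ S.coldness t :=
  integral_unit_nonneg fun x hx => (rpow_pos_of_pos (S.hθ_pos x hx t ht) _).le

lemma logGrad_nonneg (t : ℝ) : 0 ≤ S.logGrad t :=
  integral_unit_nonneg fun _ _ => by positivity

lemma clogGrad : ContRect fun x t => S.θx x t ^ 2 / S.θ x t ^ 2 :=
  (S.ctx.pow 2).div (S.ct.pow 2) fun x hx t ht => pow_pos (S.hθ_pos x hx t ht) 2

lemma timeDeriv_coldness : TimeDeriv S.coldness fun t => -S.β * ∫ x in (0 : ℝ)..1,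
    (S.θ x t ^ (-S.β - 1) * (S.stress x t * S.vx x t)
      + (S.β + 1) * (S.θx x t ^ 2 / S.θ x t ^ 2 / S.u x t)) := by
  refine (ContRect.timeDeriv_integral (S.crpow (-S.β))
    (F' := fun x t => -S.β * (S.θ x t ^ (-S.β - 1) * S.θt x t))
    ((ContRect.const _).mul ((S.crpow _).mul S.ctt)) fun x hx t ht => by
      have hx' := Ioo_subset_Icc_self hx
      refine ((hasDerivAt_θ hx' ht).rpow_const
        (Or.inl (S.hθ_pos x hx' t ht.le).ne')).congr_deriv ?_
      ring).congr_deriv fun t ht => ?_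
  have key := integral_unit_eq_of_deriv
    (g := fun x => S.θ x t ^ (-S.β - 1) * S.flux x t)
    (f₁ := fun x => S.θ x t ^ (-S.β - 1) * S.θt x t)
    (f₂ := fun x => S.θ x t ^ (-S.β - 1) * (S.stress x t * S.vx x t)
      + (S.β + 1) * (S.θx x t ^ 2 / S.θ x t ^ 2 / S.u x t))
    (fun x hx => by
      refine ((hasDerivWithinAt_rpow (-S.β - 1) hx ht.le).mul
        (hasDerivWithinAt_flux hx ht.le)).congr_deriv ?_
      have hu := (S.hu_pos x hx t ht.le).ne'
      have hθ := S.hθ_pos x hx t ht.le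
      have e : S.θ x t ^ (-S.β - 1 - 1) * S.θ x t ^ S.β = 1 / S.θ x t ^ 2 := by
        rw [← rpow_add hθ, one_div, ← rpow_natCast, ← rpow_neg hθ.le]
        congr 1; push_cast; ring
      unfold flux
      linear_combination (-S.β - 1) * S.θx x t ^ 2 / S.u x t * e)
    (((S.crpow _).mul S.ctt).slice ht.le)
    ((((S.crpow _).mul (S.cstress.mul S.cvx)).add
      ((ContRect.const _).mul ((clogGrad (S := S)).div S.cu S.hu_pos))).slice ht.le)
    (by simp [flux_zero ht.le]) (by simp [flux_one ht.le])
  rw [← key, intervalIntegral.integral_const_mul]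

lemma exists_coldness_deriv_le : ∃ c > 0, ∀ t, 0 ≤ t → -S.β * ∫ x in (0 : ℝ)..1,
    (S.θ x t ^ (-S.β - 1) * (S.stress x t * S.vx x t)
      + (S.β + 1) * (S.θx x t ^ 2 / S.θ x t ^ 2 / S.u x t))
    ≤ (1 / 2 + S.β ^ 2 / 2 * S.accel t) * S.coldness t - c * S.logGrad t := by
  obtain ⟨U, hU, hU'⟩ := exists_u_le (S := S)
  have hβ := S.hβ
  refine ⟨S.β * (S.β + 1) / U, by positivity, fun t ht => ?_⟩
  rw [← intervalIntegral.integral_const_mul]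
  have := integral_unit_le_comb (1 / 2 + S.β ^ 2 / 2 * S.accel t) (-(S.β * (S.β + 1) / U)) 0
    (((ContRect.const (-S.β)).mul (((S.crpow (-S.β - 1)).mul (S.cstress.mul S.cvx)).add
      ((ContRect.const (S.β + 1)).mul ((clogGrad (S := S)).div S.cu S.hu_pos)))).slice ht)
    ((S.crpow (-S.β)).slice ht) ((clogGrad (S := S)).slice ht) (continuousOn_const (c := (0 : ℝ)))
    fun x hx => by
      have hu := S.hu_pos x hx t ht
      have hθ := S.hθ_pos x hx t ht
      have h1 : S.stress x t ^ 2 ≤ S.accel t := stress_sq_le hx ht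
      have h2 : S.β * -S.stress x t ≤ 1 / 2 + S.β ^ 2 / 2 * S.accel t := by
        have := mul_le_mul_of_nonneg_left h1 (sq_nonneg S.β)
        linarith [sq_nonneg (1 + S.β * S.stress x t)]
      have hp := rpow_pos_of_pos hθ (-S.β - 1)
      have e : S.θ x t ^ (-S.β) = S.θ x t ^ (-S.β - 1) * S.θ x t := by
        rw [rpow_sub_one hθ.ne']; field_simp
      have h3 : S.θx x t ^ 2 / S.θ x t ^ 2 / U ≤ S.θx x t ^ 2 / S.θ x t ^ 2 / S.u x t := by
        gcongr
        exact hU' x hx t ht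
      have h4 := mul_le_mul_of_nonneg_left h3 (by positivity : 0 ≤ S.β * (S.β + 1))
      have h5 := mul_le_mul_of_nonneg_left h2 (mul_pos hp hθ).le
      have h6 : 0 ≤ S.β * (S.θ x t ^ (-S.β - 1) * (S.u x t * S.stress x t ^ 2)) := by positivity
      rw [vx_eq hx ht, e]
      have e2 : S.β * (S.β + 1) / U * (S.θx x t ^ 2 / S.θ x t ^ 2)
        = S.β * (S.β + 1) * (S.θx x t ^ 2 / S.θ x t ^ 2 / U) := by ring
      linarith
  refine this.trans (le_of_eq ?_)
  unfold coldness logGrad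
  ring

lemma exists_coldness_le : ∃ C > 0, ∀ t, 0 ≤ t → S.coldness t ≤ C := by
  obtain ⟨c, hc, δ, hδ, hθ⟩ := exists_θ_ge_of_V_lt (S := S)
  obtain ⟨k, hk, hP⟩ := exists_coldness_deriv_le (S := S)
  obtain ⟨M, hM, W, W', hW, -, -, hW0, hWM, hWD⟩ := exists_dissipation_bound (S := S)
  obtain ⟨N, hN, hVN⟩ := exists_cumV_le (S := S)
  have hβ := S.hβ
  have hC0 : 0 < c ^ (-S.β) := rpow_pos_of_pos hc _
  have hA := (hW.const_mul (S.β ^ 2 / 2)).add ((timeDeriv_cumV (S := S)).const_mul (1 / δ))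
  have hP0 := coldness_nonneg (S := S) le_rfl
  refine ⟨exp (S.β ^ 2 / 2 * M + 1 / δ * N) * (S.coldness 0 + 2 * c ^ (-S.β) + 0),
    by positivity, fun t ht => ?_⟩
  have hA0 : ∀ t, 0 ≤ t → 0 ≤ S.β ^ 2 / 2 * W t + 1 / δ * S.cumV t := fun t ht => by
    have := hW0 t ht
    have := cumV_nonneg (S := S) ht
    positivity
  have := (timeDeriv_coldness (S := S)).gronwall (l := 1 / 2) (b := 2 * c ^ (-S.β)) ht
    (by norm_num) (by positivity) hA (TimeDeriv.const 0) hP0 hA0 (fun _ _ => le_rfl)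
    (fun _ _ => le_rfl) fun s hs => by
      have h1 := hP s hs.1.le
      have h2 := coldness_nonneg (S := S) hs.1.le
      have h3 := mul_nonneg hk.le (logGrad_nonneg (S := S) s)
      have h4 := hWD s hs.1
      have h5 := heat_nonneg (S := S) s
      have h6 : S.β ^ 2 / 2 * S.accel s * S.coldness s ≤ S.β ^ 2 / 2 * W' s * S.coldness s := by
        gcongr
        linarith
      have h7 : S.coldness s - c ^ (-S.β) ≤ 1 / δ * S.V s * S.coldness s := by
        have hV := V_nonneg (S := S) hs.1.le
        rcases lt_or_ge (S.V s) δ with h | h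
        · have : S.coldness s ≤ c ^ (-S.β) :=
            integral_unit_le_of_le ((S.crpow _).slice hs.1.le) fun x hx =>
              rpow_le_rpow_of_nonpos hc (hθ s hs.1.le h x hx) (by linarith)
          have : 0 ≤ 1 / δ * S.V s * S.coldness s := by positivity
          linarith
        · have : 1 ≤ 1 / δ * S.V s := by
            rw [one_div, ← div_eq_inv_mul, one_le_div hδ]; exact h
          have := mul_le_mul_of_nonneg_right this h2
          linarith
      linarith
  refine this.trans ?_
  have := hWM t ht
  have := hVN t ht
  gcongr

/-! ### The gradient of the specific volume -/

/-- The spatial derivative of the weighted specific volume. -/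
noncomputable def wgrad (S : NSSol) (x t : ℝ) : ℝ :=
  exp (-S.potential x t) * (S.ux x t - S.v x t * S.u x t)

/-- The source term in the evolution equation of `wgrad`. -/
noncomputable def wsource (S : NSSol) (x t : ℝ) : ℝ :=
  exp (-S.potential x t) * (S.θx x t - S.v x t * S.θ x t)

lemma cwgrad : ContRect S.wgrad := S.cpotential.neg.exp.mul (S.cux.sub (S.cv.mul S.cu))

lemma cwsource : ContRect S.wsource := S.cpotential.neg.exp.mul (S.ctx.sub (S.cv.mul S.ct))

lemma hasDerivAt_potential_space {x t : ℝ} (hx : x ∈ Ioo (0 : ℝ) 1) (ht : 0 ≤ t) :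
    HasDerivAt (fun y => S.potential y t) (S.v x t) x := by
  have hc : ContinuousOn (fun y => S.v y t) (Icc 0 1) := S.cv.slice ht
  have hx' := Ioo_subset_Icc_self hx
  refine intervalIntegral.integral_hasDerivAt_right
    ((hc.mono (Icc_subset_Icc_right hx'.2)).intervalIntegrable_of_Icc hx'.1)
    (hc.stronglyMeasurableAtFilter_nhdsWithin measurableSet_Icc x |>.filter_mono ?_)
    (hc.continuousAt (Icc_mem_nhds hx.1 hx.2))
  rw [nhdsWithin_eq_nhds.2 (Icc_mem_nhds hx.1 hx.2)]

lemma hasDerivAt_weighted {f fx : ℝ → ℝ} {x t : ℝ} (hx : x ∈ Ioo (0 : ℝ) 1) (ht : 0 ≤ t)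
    (hf : HasDerivWithinAt f (fx x) (Icc 0 1) x) :
    HasDerivAt (fun y => exp (-S.potential y t) * f y)
      (exp (-S.potential x t) * (fx x - S.v x t * f x)) x := by
  refine ((hasDerivAt_potential_space hx ht).neg.exp.mul
    (hf.hasDerivAt (Icc_mem_nhds hx.1 hx.2))).congr_deriv ?_
  simp only [Pi.neg_apply]
  ring

lemma exp_mul_wvol_sub {x t : ℝ} (hx : x ∈ Icc (0 : ℝ) 1) (ht : 0 ≤ t) :
    ∫ s in (0 : ℝ)..t, exp s * (exp (-S.potential x s) * S.θ x s)
      = exp t * S.wvol x t - S.wvol x 0 := by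
  have hw := timeDeriv_wvol (S := S) hx
  have hsub : Icc 0 t ⊆ Ici (0 : ℝ) := fun s hs => hs.1
  have hc : ContinuousOn (fun s => exp s * (exp (-S.potential x s) * S.θ x s)) (Icc 0 t) :=
    continuous_exp.continuousOn.mul
      (((S.cpotential.neg.exp.mul S.ct).timeSlice hx).mono hsub)
  have := intervalIntegral.integral_eq_sub_of_hasDerivAt_of_le ht
    (f := fun s => exp s * S.wvol x s)
    (continuous_exp.continuousOn.mul (hw.cont.mono hsub))
    (fun s hs => ((hasDerivAt_exp s).mul (hw.deriv s hs.1)).congr_deriv (by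
      unfold wvol; ring)) (hc.intervalIntegrable_of_Icc ht)
  simpa using this

lemma exp_mul_wgrad_sub {x t : ℝ} (hx : x ∈ Ioo (0 : ℝ) 1) (ht : 0 ≤ t) :
    exp t * S.wgrad x t - S.wgrad x 0 = ∫ s in (0 : ℝ)..t, exp s * S.wsource x s := by
  have hsub : Icc 0 t ×ˢ Ioo (0 : ℝ) 1 ⊆ Prod.swap ⁻¹' (Icc (0 : ℝ) 1 ×ˢ Ici (0 : ℝ)) :=
    fun p hp => ⟨Ioo_subset_Icc_self hp.2, hp.1.1⟩
  have hswap : ∀ {F : ℝ → ℝ → ℝ}, ContRect F →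
      ContinuousOn (fun p : ℝ × ℝ => exp p.1 * F p.2 p.1) (Icc 0 t ×ˢ Ioo 0 1) :=
    fun hF => (continuous_exp.comp continuous_fst).continuousOn.mul
      (ContinuousOn.comp hF continuous_swap.continuousOn hsub)
  have hr := hasDerivAt_integral_param (b := fun s y => exp s * (exp (-S.potential y s) * S.θ y s))
    (b' := fun s y => exp s * S.wsource y s) ht (Ioo_mem_nhds hx.1 hx.2)
    (hswap (S.cpotential.neg.exp.mul S.ct)) (hswap S.cwsource)
    fun s hs y hy => (hasDerivAt_weighted (fx := fun z => S.θx z s) hy hs.1.le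
      (S.hθx y (Ioo_subset_Icc_self hy) s hs.1.le)).const_mul _
  have hl := ((hasDerivAt_weighted (S := S) (fx := fun z => S.ux z t) hx ht
    (S.hux x (Ioo_subset_Icc_self hx) t ht)).const_mul (exp t)).sub
    (hasDerivAt_weighted (S := S) (fx := fun z => S.ux z 0) hx le_rfl
      (S.hux x (Ioo_subset_Icc_self hx) 0 self_mem_Ici))
  refine hl.unique (hr.congr_of_eventuallyEq ?_)
  filter_upwards [Ioo_mem_nhds hx.1 hx.2] with y hy
  exact (exp_mul_wvol_sub (Ioo_subset_Icc_self hy) ht).symm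

lemma hasDerivAt_wgrad {x t : ℝ} (hx : x ∈ Ioo (0 : ℝ) 1) (ht : 0 < t) :
    HasDerivAt (fun s => S.wgrad x s) (-S.wgrad x t + S.wsource x t) t := by
  have hx' := Ioo_subset_Icc_self hx
  have hc : ContinuousOn (fun s => exp s * S.wsource x s) (Ici 0) :=
    continuous_exp.continuousOn.mul (S.cwsource.timeSlice hx')
  have hI : HasDerivAt (fun r => ∫ s in (0 : ℝ)..r, exp s * S.wsource x s)
      (exp t * S.wsource x t) t := by
    refine intervalIntegral.integral_hasDerivAt_right
      ((hc.mono fun s hs => hs.1).intervalIntegrable_of_Icc ht.le)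
      (hc.stronglyMeasurableAtFilter_nhdsWithin measurableSet_Ici t |>.filter_mono ?_)
      (hc.continuousAt (Ici_mem_nhds ht))
    rw [nhdsWithin_eq_nhds.2 (Ici_mem_nhds ht)]
  have h := ((hasDerivAt_neg t).exp).mul (hI.const_add (S.wgrad x 0))
  refine (h.congr_of_eventuallyEq ?_).congr_deriv ?_
  · filter_upwards [Ioi_mem_nhds ht] with s hs
    have := exp_mul_wgrad_sub (S := S) hx (le_of_lt hs)
    have e : exp (-s) * exp s = 1 := by rw [← exp_add]; simp
    change _ = exp (-s) * (S.wgrad x 0 + ∫ s in (0 : ℝ)..s, exp s * S.wsource x s)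
    rw [← this]
    linear_combination -S.wgrad x s * e
  · have := exp_mul_wgrad_sub (S := S) hx ht.le
    have e : exp (-t) * exp t = 1 := by rw [← exp_add]; simp
    rw [← this]
    linear_combination (S.wsource x t - S.wgrad x t) * e

/-- The squared norm `∫₀¹ wgrad²`. -/
noncomputable def volGrad (S : NSSol) (t : ℝ) : ℝ := ∫ x in (0 : ℝ)..1, S.wgrad x t ^ 2

lemma volGrad_nonneg (t : ℝ) : 0 ≤ S.volGrad t := integral_unit_nonneg fun _ _ => sq_nonneg _

lemma timeDeriv_volGrad : TimeDeriv S.volGrad fun t => ∫ x in (0 : ℝ)..1,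
    2 * (S.wgrad x t * (-S.wgrad x t + S.wsource x t)) :=
  ContRect.timeDeriv_integral (S.cwgrad.pow 2)
    ((ContRect.const 2).mul (S.cwgrad.mul (S.cwgrad.neg.add S.cwsource)))
    fun x hx t ht => ((hasDerivAt_wgrad hx ht).pow 2).congr_deriv (by ring)

lemma exists_θ_sq_le : ∃ C > 0, ∀ t, 0 ≤ t → ∀ x ∈ Icc (0 : ℝ) 1,
    S.θ x t ^ 2 ≤ C * (1 + S.V t) := by
  obtain ⟨M, hM, -, -, -, -, hQ, -⟩ := exists_dissipation_bound (S := S)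
  obtain ⟨U, hU, hU'⟩ := exists_u_le (S := S)
  have hβ := S.hβ
  have hE := E₀_pos (S := S)
  set a := 2 * (S.E₀ ^ (S.β + 1)) ^ 2 with ha
  set b := 2 * ((S.β + 1) ^ 2 * (U * M)) with hb
  have ha0 : 0 ≤ a := by positivity
  have hb0 : 0 ≤ b := by positivity
  refine ⟨1 + a + b, by positivity, fun t ht x hx => ?_⟩
  have hθ := S.hθ_pos x hx t ht
  have hV := V_nonneg (S := S) ht
  have h1 := rpow_le_one_add_rpow hθ (by norm_num : (0 : ℝ) ≤ 2)
    (by linarith : (2 : ℝ) ≤ (S.β + 1) * 2)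
  rw [rpow_mul hθ.le, rpow_two, rpow_two] at h1
  have h2 : (S.θ x t ^ (S.β + 1) - S.meanθ t ^ (S.β + 1)) ^ 2
      ≤ (S.β + 1) ^ 2 * (S.V t * (U * M)) :=
    (sq_rpow_sub_meanθ_le hU' hx ht).trans (by gcongr; exact hQ t ht)
  have hm := meanθ_pos (S := S) ht
  have h3 : S.meanθ t ^ (S.β + 1) ≤ S.E₀ ^ (S.β + 1) :=
    rpow_le_rpow hm.le (integral_θ_le ht) (by linarith)
  have h4 := pow_le_pow_left₀ (rpow_pos_of_pos hm _).le h3 2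
  have h5 := sq_nonneg (S.θ x t ^ (S.β + 1) - 2 * S.meanθ t ^ (S.β + 1))
  have h6 : 0 ≤ a * S.V t := by positivity
  linarith

lemma exists_volGrad_deriv_le : ∃ K > 0, ∀ t, 0 ≤ t → ∫ x in (0 : ℝ)..1,
    2 * (S.wgrad x t * (-S.wgrad x t + S.wsource x t))
      ≤ -S.volGrad t + K * (S.logGrad t + S.heat t + 1 + S.V t) := by
  obtain ⟨C, hC, hθ'⟩ := exists_θ_sq_le (S := S)
  have hβ := S.hβ
  have hE := E₀_pos (S := S)
  set e := exp (1 / 2 + S.E₀) with he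
  have he0 : 0 < e := exp_pos _
  refine ⟨2 * e ^ 2 * (1 + 2 * C * S.E₀), by positivity, fun t ht => ?_⟩
  have hV := V_nonneg (S := S) ht
  have h := integral_unit_le_comb (-1) (2 * e ^ 2) (2 * e ^ 2 * (C * (1 + S.V t)))
    (((ContRect.const 2).mul (S.cwgrad.mul (S.cwgrad.neg.add S.cwsource))).slice ht)
    ((S.cwgrad.pow 2).slice ht)
    (((clogGrad (S := S)).add (((S.crpow S.β).mul S.ctx).pow 2)).slice ht)
    ((S.cv.pow 2).slice ht) fun x hx => by
      have hθ := S.hθ_pos x hx t ht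
      have h1 := rpow_le_one_add_rpow hθ (by norm_num : (0 : ℝ) ≤ 2)
        (by linarith : (2 : ℝ) ≤ (S.β + 1) * 2)
      rw [rpow_mul hθ.le, rpow_two, rpow_two, rpow_add_one hθ.ne'] at h1
      have h2 : S.θx x t ^ 2 ≤ S.θx x t ^ 2 / S.θ x t ^ 2 + (S.θ x t ^ S.β * S.θx x t) ^ 2 := by
        have := mul_le_mul_of_nonneg_left h1
          (by positivity : 0 ≤ S.θx x t ^ 2 / S.θ x t ^ 2)
        have e1 : S.θx x t ^ 2 / S.θ x t ^ 2 * S.θ x t ^ 2 = S.θx x t ^ 2 := by field_simp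
        linear_combination this + ((S.θ x t ^ S.β) ^ 2 - 1) * e1
      have h3 := mul_le_mul_of_nonneg_right (hθ' t ht x hx) (sq_nonneg (S.v x t))
      have h4 := pow_le_pow_left₀ (exp_pos _).le (exp_neg_potential_le (S := S) hx ht) 2
      have h5 : S.wsource x t ^ 2 ≤ e ^ 2 * (S.θx x t - S.v x t * S.θ x t) ^ 2 := by
        unfold wsource
        rw [mul_pow]
        gcongr
      have h6 : (S.θx x t - S.v x t * S.θ x t) ^ 2
          ≤ 2 * (S.θx x t ^ 2 / S.θ x t ^ 2 + (S.θ x t ^ S.β * S.θx x t) ^ 2)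
            + 2 * (C * (1 + S.V t) * S.v x t ^ 2) := by
        linarith [sq_nonneg (S.θx x t + S.v x t * S.θ x t)]
      have h7 := mul_le_mul_of_nonneg_left h6 (sq_nonneg e)
      linarith [sq_nonneg (S.wgrad x t - S.wsource x t)]
  have hs : ∫ x in (0 : ℝ)..1, (S.θx x t ^ 2 / S.θ x t ^ 2 + (S.θ x t ^ S.β * S.θx x t) ^ 2)
      = S.logGrad t + S.heat t :=
    intervalIntegral.integral_add ((clogGrad (S := S)).slice ht).intervalIntegrable_unit
      ((((S.crpow S.β).mul S.ctx).pow 2).slice ht).intervalIntegrable_unit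
  rw [hs] at h
  have h1 := mul_le_mul_of_nonneg_left (integral_v_sq_le (S := S) ht)
    (by positivity : 0 ≤ 2 * e ^ 2 * (C * (1 + S.V t)))
  have h2 := logGrad_nonneg (S := S) t
  have h3 := heat_nonneg (S := S) t
  have h4 : 0 ≤ 2 * e ^ 2 * (2 * C * S.E₀) * (S.logGrad t + S.heat t) := by positivity
  have h5 : 0 ≤ 2 * e ^ 2 * (1 + S.V t) := by positivity
  unfold volGrad
  linarith

lemma exists_volGrad_le : ∃ C > 0, ∀ t, 0 ≤ t → S.volGrad t ≤ C := by
  obtain ⟨k, hk, hP⟩ := exists_coldness_deriv_le (S := S)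
  obtain ⟨M, hM, hPM⟩ := exists_coldness_le (S := S)
  obtain ⟨K, hK, hG⟩ := exists_volGrad_deriv_le (S := S)
  obtain ⟨M', hM', W, W', hW, -, -, hW0, hWM, hWD⟩ := exists_dissipation_bound (S := S)
  obtain ⟨N, hN, hVN⟩ := exists_cumV_le (S := S)
  have hY := (timeDeriv_volGrad (S := S)).add ((timeDeriv_coldness (S := S)).const_mul (K / k))
  set L := K + K / k * (S.β ^ 2 / 2 * M) with hL
  have hL0 : 0 < L := by positivity
  have hB := ((timeDeriv_cumV (S := S)).const_mul K).add (hW.const_mul L)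
  have hB0 : ∀ t, 0 ≤ t → 0 ≤ K * S.cumV t + L * W t := fun t ht => by
    have := hW0 t ht
    have := cumV_nonneg (S := S) ht
    positivity
  have hWD' : ∀ t, 0 < t → 0 ≤ W' t := fun t ht => by
    linarith [hWD t ht, accel_nonneg (S := S) t, heat_nonneg (S := S) t]
  have hkK : K / k * k = K := by field_simp
  have hY0 : ∀ t, 0 ≤ t → 0 ≤ S.volGrad t + K / k * S.coldness t := fun t ht => by
    have := coldness_nonneg (S := S) ht
    have := volGrad_nonneg (S := S) t
    positivity
  set b := K + 3 / 2 * (K / k * M) with hb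
  have hb0 : 0 ≤ b := by positivity
  refine ⟨exp 0 * (S.volGrad 0 + K / k * S.coldness 0 + b + (K * N + L * M')) + 1,
    by have := hY0 0 le_rfl; positivity, fun t ht => ?_⟩
  have := hY.gronwall (l := 1) (b := b) ht zero_le_one hb0 (TimeDeriv.const 0) hB
    (hY0 0 le_rfl) (fun _ _ => le_rfl) hB0 (fun s hs => by
      have := hWD' s hs.1
      have := V_nonneg (S := S) hs.1.le
      positivity) fun s hs => by
      have h1 := hG s hs.1.le
      have h2 := mul_le_mul_of_nonneg_left (hP s hs.1.le) (by positivity : 0 ≤ K / k)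
      have h3 := hPM s hs.1.le
      have h4 := accel_nonneg (S := S) s
      have h5 := heat_nonneg (S := S) s
      have h6 : K / k * (3 / 2 + S.β ^ 2 / 2 * S.accel s) * S.coldness s
          ≤ K / k * (3 / 2 + S.β ^ 2 / 2 * S.accel s) * M := by gcongr
      have h7 := mul_le_mul_of_nonneg_left (hWD s hs.1) hL0.le
      have h8 : 0 ≤ K / k * (S.β ^ 2 / 2 * M) * S.heat s := by positivity
      have h9 : 0 ≤ K * S.accel s := by positivity
      have h10 : K / k * (k * S.logGrad s) = K * S.logGrad s := by rw [← mul_assoc, hkK]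
      have h11 : L * (S.accel s + S.heat s)
          = (K + K / k * (S.β ^ 2 / 2 * M)) * (S.accel s + S.heat s) := by rw [hL]
      linarith
  have h1 := hWM t ht
  have h2 := hVN t ht
  have h3 : exp 0 * (S.volGrad 0 + K / k * S.coldness 0 + b + (K * S.cumV t + L * W t))
      ≤ exp 0 * (S.volGrad 0 + K / k * S.coldness 0 + b + (K * N + L * M')) := by gcongr
  have h4 : 0 ≤ K / k * S.coldness t := by
    have := coldness_nonneg (S := S) ht
    positivity
  linarith

lemma exists_integral_ux_sq_le : ∃ C > 0, ∀ t, 0 ≤ t → ∫ x in (0 : ℝ)..1, S.ux x t ^ 2 ≤ C := by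
  obtain ⟨M, hM, hG⟩ := exists_volGrad_le (S := S)
  obtain ⟨U, hU, hU'⟩ := exists_u_le (S := S)
  have hE := E₀_pos (S := S)
  set e := exp (1 / 2 + S.E₀) with he
  have he0 : 0 < e := exp_pos _
  refine ⟨2 * e ^ 2 * M + 2 * U ^ 2 * (2 * S.E₀), by positivity, fun t ht => ?_⟩
  have h := integral_unit_le_comb (2 * e ^ 2) (2 * U ^ 2) 0 ((S.cux.pow 2).slice ht)
    ((S.cwgrad.pow 2).slice ht) ((S.cv.pow 2).slice ht) (continuousOn_const (c := (0 : ℝ)))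
    fun x hx => by
      have h1 := pow_le_pow_left₀ zero_le_one (one_le_mul_exp_neg_potential (S := S) hx ht) 2
      have h2 := mul_le_mul_of_nonneg_right h1 (sq_nonneg (S.ux x t - S.v x t * S.u x t))
      have h3 := pow_le_pow_left₀ (S.hu_pos x hx t ht).le (hU' x hx t ht) 2
      have h4 := mul_le_mul_of_nonneg_right h3 (sq_nonneg (S.v x t))
      have h5 : (exp (1 / 2 + S.E₀) * exp (-S.potential x t)) ^ 2
          * (S.ux x t - S.v x t * S.u x t) ^ 2 = e ^ 2 * S.wgrad x t ^ 2 := by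
        unfold wgrad; ring
      rw [h5] at h2
      linarith [sq_nonneg (S.ux x t - 2 * (S.v x t * S.u x t))]
  have h1 := mul_le_mul_of_nonneg_left (hG t ht) (by positivity : 0 ≤ 2 * e ^ 2)
  have h2 := mul_le_mul_of_nonneg_left (integral_v_sq_le (S := S) ht)
    (by positivity : 0 ≤ 2 * U ^ 2)
  unfold volGrad at h1
  linarith

/-! ### The final estimate -/

lemma vxx_sub_eq {x t : ℝ} (hx : x ∈ Icc (0 : ℝ) 1) (ht : 0 ≤ t) :
    S.vxx x t - S.θx x t = S.ux x t * S.stress x t + S.u x t * S.vt x t := by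
  refine (uniqueDiffOn_Icc zero_lt_one x hx).eq_deriv _
    ((S.hvxx x hx t ht).sub (S.hθx x hx t ht)) ?_
  refine ((S.hux x hx t ht).mul (hasDerivWithinAt_stress hx ht)).congr_of_mem
    (fun y hy => ?_) hx
  have := vx_eq (S := S) hy ht
  simp only [Pi.sub_apply, Pi.mul_apply]
  linarith

lemma exists_rate_le : ∃ C > 0, ∀ t, 0 ≤ t → ∫ x in (0 : ℝ)..1,
    ((S.vxx x t - S.θx x t) ^ 2 + S.θ x t * (S.vx x t - S.θ x t) ^ 2) ≤ C * S.accel t := by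
  obtain ⟨M, hM, hux⟩ := exists_integral_ux_sq_le (S := S)
  obtain ⟨U, hU, hU'⟩ := exists_u_le (S := S)
  have hE := E₀_pos (S := S)
  refine ⟨2 * M + 2 * U ^ 2 + U ^ 2 * S.E₀, by positivity, fun t ht => ?_⟩
  have hD := accel_nonneg (S := S) t
  have cvxx : ContRect S.vxx := S.hvxx_cont
  have h := integral_unit_le_comb (2 * S.accel t) (2 * U ^ 2) (U ^ 2 * S.accel t)
    ((((cvxx.sub S.ctx).pow 2).add (S.ct.mul ((S.cvx.sub S.ct).pow 2))).slice ht)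
    ((S.cux.pow 2).slice ht) ((S.cvt.pow 2).slice ht) (S.ct.slice ht) fun x hx => by
      have hθ := S.hθ_pos x hx t ht
      have h1 : S.stress x t ^ 2 ≤ S.accel t := stress_sq_le hx ht
      have h2 := pow_le_pow_left₀ (S.hu_pos x hx t ht).le (hU' x hx t ht) 2
      have h3 := mul_le_mul_of_nonneg_left h1 (sq_nonneg (S.ux x t))
      have h4 := mul_le_mul_of_nonneg_right h2 (sq_nonneg (S.vt x t))
      have h5 : S.u x t ^ 2 * S.stress x t ^ 2 * S.θ x t ≤ U ^ 2 * S.accel t * S.θ x t := by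
        gcongr
      have h6 : S.vx x t - S.θ x t = S.u x t * S.stress x t := by
        rw [vx_eq hx ht]; ring
      rw [vxx_sub_eq hx ht, h6]
      linarith [sq_nonneg (S.ux x t * S.stress x t - S.u x t * S.vt x t)]
  have h1 := mul_le_mul_of_nonneg_left (hux t ht) hD
  have h2 := mul_le_mul_of_nonneg_left (integral_θ_le (S := S) ht)
    (by positivity : 0 ≤ U ^ 2 * S.accel t)
  have h3 : ∫ x in (0 : ℝ)..1, S.vt x t ^ 2 = S.accel t := rfl
  rw [h3] at h
  linarith

lemma exists_integral_sq_le : ∃ C > 0, ∀ t, 0 ≤ t →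
    ∫ x in (0 : ℝ)..1, (S.vx x t - S.θ x t) ^ 2 ≤ C := by
  obtain ⟨M, hM, -, -, -, hF, -⟩ := exists_dissipation_bound (S := S)
  obtain ⟨U, hU, hU'⟩ := exists_u_le (S := S)
  refine ⟨U * M, by positivity, fun t ht => ?_⟩
  have h := integral_unit_le_comb U 0 0 (((S.cvx.sub S.ct).pow 2).slice ht)
    ((S.cu.mul (S.cstress.pow 2)).slice ht) (continuousOn_const (c := (0 : ℝ)))
    (continuousOn_const (c := (0 : ℝ))) fun x hx => by
      have h1 := mul_le_mul_of_nonneg_right (hU' x hx t ht)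
        (mul_nonneg (S.hu_pos x hx t ht).le (sq_nonneg (S.stress x t)))
      have h6 : S.vx x t - S.θ x t = S.u x t * S.stress x t := by
        rw [vx_eq hx ht]; ring
      rw [h6]
      linarith
  have h1 := mul_le_mul_of_nonneg_left (hF t ht) hU.le
  unfold stressEnergy at h1
  linarith

lemma exists_integral_rate_le : ∃ C > 0, ∀ T, 0 < T → ∫ t in (0 : ℝ)..T, ∫ x in (0 : ℝ)..1,
    ((S.vxx x t - S.θx x t) ^ 2 + S.θ x t * (S.vx x t - S.θ x t) ^ 2) ≤ C := by
  obtain ⟨M, hM, W, W', hW, -, -, hW0, hWM, hWD⟩ := exists_dissipation_bound (S := S)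
  obtain ⟨C, hC, hR⟩ := exists_rate_le (S := S)
  have cvxx : ContRect S.vxx := S.hvxx_cont
  have hc := (((cvxx.sub S.ctx).pow 2).add (S.ct.mul ((S.cvx.sub S.ct).pow 2))).continuousOn_integral
  refine ⟨C * M, by positivity, fun T hT => ?_⟩
  have hsub : Icc 0 T ⊆ Ici (0 : ℝ) := fun s hs => hs.1
  have hCW := hW.const_mul C
  have h := intervalIntegral.integral_le_sub_of_hasDeriv_right_of_le hT.le
    (hCW.cont.mono hsub) (fun t ht => (hCW.deriv t ht.1).hasDerivWithinAt)
    ((hc.mono hsub).integrableOn_compact isCompact_Icc) fun t ht => by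
      have h1 := hR t ht.1.le
      have h2 := heat_nonneg (S := S) t
      have h3 := mul_le_mul_of_nonneg_left (hWD t ht.1) hC.le
      have h4 := mul_nonneg hC.le h2
      linarith
  have h1 := mul_le_mul_of_nonneg_left (hWM T hT.le) hC.le
  have h2 := mul_nonneg hC.le (hW0 0 le_rfl)
  linarith

end NSSol

/-- Uniform-in-time bound:
`∫₀¹ (w_x+u−θ)²(·,T) + ∫₀ᵀ∫₀¹ ((w_{xx}+u_x−θ_x)² + θ(w_x+u−θ)²) ≤ C`,
where `w_x + u − θ = v_x − θ` and `w_{xx} + u_x − θ_x = v_{xx} − θ_x`. -/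
theorem stress_H1_bound (S : NSSol) :
    ∃ C > (0:ℝ), ∀ T > (0:ℝ),
      (∫ x in (0:ℝ)..1, (S.vx x T - S.θ x T) ^ 2)
        + (∫ t in (0:ℝ)..T, ∫ x in (0:ℝ)..1,
            ((S.vxx x t - S.θx x t) ^ 2
              + S.θ x t * (S.vx x t - S.θ x t) ^ 2)) ≤ C := by
  obtain ⟨C₁, hC₁, h₁⟩ := NSSol.exists_integral_sq_le (S := S)
  obtain ⟨C₂, hC₂, h₂⟩ := NSSol.exists_integral_rate_le (S := S)
  exact ⟨C₁ + C₂, by positivity, fun T hT => add_le_add (h₁ T hT.le) (h₂ T hT)⟩
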